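/- arXiv:2210.04804 — 3 statements merged into one kernel-verified Lean document; each statement's English description precedes it below -/
import Mathlib

section
/- Let A : [1,∞) → ℝ^{d×d} be continuous and let T(t,s) be the evolution family of the linear equation x' = A(t)x, t≥1. Then the following are equivalent: (1) the equation x' = A(t)x admits a nonuniform strong polynomial dichotomy; (2) there exists a family of norms (‖·‖_t)_{t≥1} on ℝ^d with respect to which the equation admits a strong polynomial dichotomy, and there exist C>0, δ≥0 such that ‖x‖ ≤ ‖x‖_t ≤ C·t^δ·‖x‖ for all x∈ℝ^d and t≥1. -/
noncomputable section

namespace NonautLin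

variable {E : Type*} [NormedAddCommGroup E] [NormedSpace ℝ E]

/-- `N : E → ℝ` is a norm on the real vector space `E`. -/
def IsNormOn (N : E → ℝ) : Prop :=
  (∀ x, 0 ≤ N x) ∧ (∀ x, N x = 0 ↔ x = 0) ∧
  (∀ (c : ℝ) (x : E), N (c • x) = |c| * N x) ∧
  (∀ x y : E, N (x + y) ≤ N x + N y)

/-- Multiplication by the scalar `c` as a continuous linear equivalence
(junk value `id` for `c = 0`). -/
def smulCLE (c : ℝ) : E ≃L[ℝ] E :=
  if hc : c = 0 then ContinuousLinearEquiv.refl ℝ E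
  else
    { toFun := fun x => c • x
      invFun := fun x => c⁻¹ • x
      map_add' := fun x y => smul_add c x y
      map_smul' := fun a x => smul_comm c a x
      left_inv := fun x => by simp [smul_smul, inv_mul_cancel₀ hc]
      right_inv := fun x => by simp [smul_smul, mul_inv_cancel₀ hc]
      continuous_toFun := continuous_const_smul c
      continuous_invFun := continuous_const_smul c⁻¹ }

/-- The operator `c • A` as a continuous linear equivalence. -/
def scale (c : ℝ) (A : E ≃L[ℝ] E) : E ≃L[ℝ] E := A.trans (smulCLE c)

/-- `T` is the evolution family of the linear equation `x' = A(t)x` on `[1,∞)`. -/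
def IsEvolutionFamily (A : ℝ → (E →L[ℝ] E)) (T : ℝ → ℝ → (E ≃L[ℝ] E)) : Prop :=
  (∀ s : ℝ, 1 ≤ s → T s s = ContinuousLinearEquiv.refl ℝ E) ∧
  (∀ t r s : ℝ, 1 ≤ s → 1 ≤ r → 1 ≤ t → ∀ x : E, T t r (T r s x) = T t s x) ∧
  (∀ s : ℝ, 1 ≤ s → ∀ x : E, ∀ t : ℝ, 1 ≤ t →
    HasDerivWithinAt (fun τ => T τ s x) (A t (T t s x)) (Set.Ici 1) t)

/-- Nonuniform strong polynomial dichotomy for an evolution family, with nonuniformity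
exponent `eps`. -/
def CNonuniformStrongPolyDichotomyWith (T : ℝ → ℝ → (E ≃L[ℝ] E)) (eps : ℝ) : Prop :=
  ∃ K lam a : ℝ, 0 < K ∧ 0 < lam ∧ lam ≤ a ∧
    ∃ P : ℝ → (E →L[ℝ] E),
      (∀ t : ℝ, 1 ≤ t → (P t).comp (P t) = P t) ∧
      (∀ t s : ℝ, 1 ≤ s → s ≤ t →
        (P t).comp (T t s : E →L[ℝ] E) = ((T t s : E →L[ℝ] E)).comp (P s)) ∧
      (∀ t s : ℝ, 1 ≤ s → s ≤ t →
        ‖((T t s : E →L[ℝ] E)).comp (P s)‖ ≤ K * (t / s) ^ (-lam) * s ^ eps ∧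
        ‖((T s t : E →L[ℝ] E)).comp (ContinuousLinearMap.id ℝ E - P t)‖
          ≤ K * (t / s) ^ (-lam) * t ^ eps ∧
        ‖(T t s : E →L[ℝ] E)‖ ≤ K * (t / s) ^ a * s ^ eps ∧
        ‖(T s t : E →L[ℝ] E)‖ ≤ K * (t / s) ^ a * t ^ eps)

/-- Nonuniform strong polynomial dichotomy for an evolution family. -/
def CNonuniformStrongPolyDichotomy (T : ℝ → ℝ → (E ≃L[ℝ] E)) : Prop :=
  ∃ eps : ℝ, 0 ≤ eps ∧ CNonuniformStrongPolyDichotomyWith T eps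

/-- Strong polynomial dichotomy for an evolution family w.r.t. a family of norms. -/
def CStrongPolyDichotomyWRT (T : ℝ → ℝ → (E ≃L[ℝ] E)) (N : ℝ → E → ℝ) : Prop :=
  ∃ K lam a : ℝ, 0 < K ∧ 0 < lam ∧ lam ≤ a ∧
    ∃ P : ℝ → (E →L[ℝ] E),
      (∀ t : ℝ, 1 ≤ t → (P t).comp (P t) = P t) ∧
      (∀ t s : ℝ, 1 ≤ s → s ≤ t →
        (P t).comp (T t s : E →L[ℝ] E) = ((T t s : E →L[ℝ] E)).comp (P s)) ∧
      (∀ t s : ℝ, 1 ≤ s → s ≤ t → ∀ x : E,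
        N t (T t s (P s x)) ≤ K * (t / s) ^ (-lam) * N s x ∧
        N s (T s t (x - P t x)) ≤ K * (t / s) ^ (-lam) * N t x ∧
        N t (T t s x) ≤ K * (t / s) ^ a * N s x ∧
        N s (T s t x) ≤ K * (t / s) ^ a * N t x)

/-- The continuous-time polynomial dichotomy spectrum, defined via the evolution family
`(t/s)^{-τ} T(t,s)` of the shifted equation `x' = (A(t) - (τ/t) Id) x`. -/
def SigmaPDc (T : ℝ → ℝ → (E ≃L[ℝ] E)) (N : ℝ → E → ℝ) : Set ℝ :=
  {τ | ¬ CStrongPolyDichotomyWRT (fun t s => scale ((t / s) ^ (-τ)) (T t s)) N}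

/-- `u` is a solution of the linear equation `x' = A(t)x` on `[1,∞)`. -/
def IsLinSolution (A : ℝ → (E →L[ℝ] E)) (u : ℝ → E) : Prop :=
  ∀ t : ℝ, 1 ≤ t → HasDerivWithinAt u (A t (u t)) (Set.Ici 1) t

/-- `u` is a solution of the semilinear equation `x' = A(t)x + f(t,x)` on `[1,∞)`. -/
def IsSemilinSolution (A : ℝ → (E →L[ℝ] E)) (f : ℝ → E → E) (u : ℝ → E) : Prop :=
  ∀ t : ℝ, 1 ≤ t → HasDerivWithinAt u (A t (u t) + f t (u t)) (Set.Ici 1) t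

/-- The supremum over `τ ≥ 1` of the weighted orbit norms `w τ t * ‖T(τ,t) R(t) x‖`. -/
def weightedOrbitSup (T : ℝ → ℝ → (E ≃L[ℝ] E)) (R : ℝ → (E →L[ℝ] E)) (w : ℝ → ℝ → ℝ)
    (t : ℝ) (x : E) : ℝ :=
  ⨆ τ : Set.Ici (1 : ℝ), w τ t * ‖T τ t (R t x)‖

section WeightedOrbitSup

variable {T : ℝ → ℝ → (E ≃L[ℝ] E)} {R : ℝ → (E →L[ℝ] E)} {w : ℝ → ℝ → ℝ} {t s b c : ℝ} {x y : E}

lemma weightedOrbitSup_le (h : ∀ τ, 1 ≤ τ → w τ t * ‖T τ t (R t x)‖ ≤ b) :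
    weightedOrbitSup T R w t x ≤ b :=
  haveI : Nonempty (Set.Ici (1 : ℝ)) := ⟨⟨1, Set.self_mem_Ici⟩⟩
  ciSup_le fun τ => h τ τ.2

lemma le_weightedOrbitSup (h : ∀ τ, 1 ≤ τ → w τ t * ‖T τ t (R t x)‖ ≤ b) {τ : ℝ} (hτ : 1 ≤ τ) :
    w τ t * ‖T τ t (R t x)‖ ≤ weightedOrbitSup T R w t x :=
  le_ciSup (f := fun τ : Set.Ici (1 : ℝ) => w τ t * ‖T τ t (R t x)‖)
    ⟨b, by rintro _ ⟨τ, rfl⟩; exact h τ τ.2⟩ ⟨τ, hτ⟩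

lemma weightedOrbitSup_nonneg (hw : ∀ τ, 1 ≤ τ → 0 ≤ w τ t) :
    0 ≤ weightedOrbitSup T R w t x :=
  Real.iSup_nonneg fun τ => mul_nonneg (hw τ τ.2) (norm_nonneg _)

lemma weightedOrbitSup_eq_zero (h : R t x = 0) : weightedOrbitSup T R w t x = 0 := by
  simp [weightedOrbitSup, h]

lemma weightedOrbitSup_congr (h : R t x = R t y) :
    weightedOrbitSup T R w t x = weightedOrbitSup T R w t y := by
  simp [weightedOrbitSup, h]

lemma weightedOrbitSup_smul (c : ℝ) :
    weightedOrbitSup T R w t (c • x) = |c| * weightedOrbitSup T R w t x := by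
  simp only [weightedOrbitSup, Real.mul_iSup_of_nonneg (abs_nonneg c), map_smul, norm_smul,
    Real.norm_eq_abs, mul_left_comm]

lemma weightedOrbitSup_add_le (hw : ∀ τ, 1 ≤ τ → 0 ≤ w τ t)
    (h : ∀ τ, 1 ≤ τ → ∀ x, w τ t * ‖T τ t (R t x)‖ ≤ b * ‖x‖) :
    weightedOrbitSup T R w t (x + y) ≤ weightedOrbitSup T R w t x + weightedOrbitSup T R w t y := by
  refine weightedOrbitSup_le fun τ hτ => ?_
  have hx := le_weightedOrbitSup (fun τ hτ => h τ hτ x) hτ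
  have hy := le_weightedOrbitSup (fun τ hτ => h τ hτ y) hτ
  rw [map_add, map_add]
  linarith [mul_le_mul_of_nonneg_left (norm_add_le (T τ t (R t x)) (T τ t (R t y))) (hw τ hτ)]

lemma weightedOrbitSup_map_le (hx : ∀ τ, 1 ≤ τ → w τ s * ‖T τ s (R s x)‖ ≤ b) (hc : 0 ≤ c)
    (hT : ∀ τ, 1 ≤ τ → T τ t (R t (T t s x)) = T τ s (R s x))
    (hw : ∀ τ, 1 ≤ τ → w τ t ≤ c * w τ s) :
    weightedOrbitSup T R w t (T t s x) ≤ c * weightedOrbitSup T R w s x := by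
  refine weightedOrbitSup_le fun τ hτ => ?_
  rw [hT τ hτ]
  calc w τ t * ‖T τ s (R s x)‖ ≤ c * w τ s * ‖T τ s (R s x)‖ := by gcongr; exact hw τ hτ
    _ = c * (w τ s * ‖T τ s (R s x)‖) := mul_assoc ..
    _ ≤ _ := by gcongr; exact le_weightedOrbitSup hx hτ

end WeightedOrbitSup

section MinRpow

variable {lam a r c : ℝ}

/-- Equals `r ^ lam` for `r ≥ 1` and `r ^ a` for `0 < r ≤ 1` when `lam ≤ a`. -/
def minRpow (lam a r : ℝ) : ℝ := min (r ^ lam) (r ^ a)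

lemma minRpow_nonneg (hr : 0 ≤ r) : 0 ≤ minRpow lam a r :=
  le_min (Real.rpow_nonneg hr _) (Real.rpow_nonneg hr _)

lemma minRpow_one : minRpow lam a 1 = 1 := by simp [minRpow]

lemma minRpow_mul_le_of_le_one (hla : lam ≤ a) (hr : 0 ≤ r) (hc : 0 < c) (hc1 : c ≤ 1) :
    minRpow lam a (c * r) ≤ c ^ lam * minRpow lam a r := by
  have h := Real.rpow_le_rpow_of_exponent_ge hc hc1 hla
  rw [minRpow, minRpow, mul_min_of_nonneg _ _ (Real.rpow_nonneg hc.le _),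
    Real.mul_rpow hc.le hr, Real.mul_rpow hc.le hr]
  exact min_le_min le_rfl (mul_le_mul_of_nonneg_right h (Real.rpow_nonneg hr _))

lemma minRpow_mul_le_of_one_le (hla : lam ≤ a) (hr : 0 ≤ r) (hc1 : 1 ≤ c) :
    minRpow lam a (c * r) ≤ c ^ a * minRpow lam a r := by
  have hc : 0 ≤ c := zero_le_one.trans hc1
  have h := Real.rpow_le_rpow_of_exponent_le hc1 hla
  rw [minRpow, minRpow, mul_min_of_nonneg _ _ (Real.rpow_nonneg hc _),
    Real.mul_rpow hc hr, Real.mul_rpow hc hr]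
  exact min_le_min (mul_le_mul_of_nonneg_right h (Real.rpow_nonneg hr _)) le_rfl

end MinRpow

/-- Operators that commute with the evolution family forward in time also do so backward. -/
lemma commute_evolution_of_forward {A : ℝ → (E →L[ℝ] E)} {T : ℝ → ℝ → (E ≃L[ℝ] E)}
    (hT : IsEvolutionFamily A T) {R : ℝ → (E →L[ℝ] E)}
    (hR : ∀ t s : ℝ, 1 ≤ s → s ≤ t → ∀ x, R t (T t s x) = T t s (R s x))
    {t s : ℝ} (ht : 1 ≤ t) (hs : 1 ≤ s) (x : E) : R t (T t s x) = T t s (R s x) := by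
  rcases le_total s t with h | h
  · exact hR t s hs h x
  · apply (T s t).injective
    rw [← hR s t ht h, hT.2.1 s t s hs ht hs, hT.2.1 s t s hs ht hs, hT.1 s hs]
    rfl

section WeightedOpNorm

variable {w t K eps a lam ρ : ℝ}

lemma weighted_norm_apply_le {M : E →L[ℝ] E} (hρ : 0 < ρ) (ht : 1 ≤ t) (hK : 0 < K)
    (heps : 0 ≤ eps) (hwρ : w ≤ ρ ^ lam)
    (hM : ‖M‖ ≤ K * ρ ^ (-lam) * t ^ eps) (x : E) :
    w * ‖M x‖ ≤ (K + K ^ 2) * t ^ (2 * eps) * ‖x‖ := by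
  have he : t ^ eps ≤ t ^ (2 * eps) := Real.rpow_le_rpow_of_exponent_le ht (by linarith)
  have hc : ρ ^ lam * ρ ^ (-lam) = 1 := by rw [← Real.rpow_add hρ]; simp
  calc w * ‖M x‖ ≤ ρ ^ lam * (K * ρ ^ (-lam) * t ^ eps * ‖x‖) := by
        gcongr; exact M.le_of_opNorm_le hM x
    _ = K * t ^ eps * ‖x‖ := by linear_combination K * t ^ eps * ‖x‖ * hc
    _ ≤ K * t ^ (2 * eps) * ‖x‖ := by gcongr
    _ ≤ _ := by gcongr; nlinarith

lemma weighted_norm_comp_apply_le {L B : E →L[ℝ] E} (hρ : 0 < ρ) (ht : 0 < t) (hK : 0 < K)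
    (hwρ : w ≤ ρ ^ (-a))
    (hL : ‖L‖ ≤ K * ρ ^ a * t ^ eps) (hB : ‖B‖ ≤ K * t ^ eps) (x : E) :
    w * ‖L (B x)‖ ≤ (K + K ^ 2) * t ^ (2 * eps) * ‖x‖ := by
  have he : t ^ (2 * eps) = t ^ eps * t ^ eps := by rw [← Real.rpow_add ht]; ring_nf
  have hc : ρ ^ (-a) * ρ ^ a = 1 := by rw [← Real.rpow_add hρ]; simp
  calc w * ‖L (B x)‖ ≤ ρ ^ (-a) * (K * ρ ^ a * t ^ eps * (K * t ^ eps * ‖x‖)) := by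
        gcongr; exact L.le_of_opNorm_le_of_le hL (B.le_of_opNorm_le hB x)
    _ = K ^ 2 * t ^ (2 * eps) * ‖x‖ := by
        rw [he]; linear_combination K ^ 2 * t ^ eps * t ^ eps * ‖x‖ * hc
    _ ≤ _ := by gcongr; nlinarith

end WeightedOpNorm

theorem exists_norms_of_nonuniform {A : ℝ → (E →L[ℝ] E)} {T : ℝ → ℝ → (E ≃L[ℝ] E)}
    (hT : IsEvolutionFamily A T) (h : CNonuniformStrongPolyDichotomy T) :
    ∃ N : ℝ → E → ℝ, (∀ t : ℝ, 1 ≤ t → IsNormOn (N t)) ∧ CStrongPolyDichotomyWRT T N ∧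
      ∃ C δ : ℝ, 0 < C ∧ 0 ≤ δ ∧
        ∀ t : ℝ, 1 ≤ t → ∀ x : E, ‖x‖ ≤ N t x ∧ N t x ≤ C * t ^ δ * ‖x‖ := by
  obtain ⟨eps, heps, K, lam, a, hK, hlam, hla, P, hPP, hPT, hest⟩ := h
  set Q : ℝ → (E →L[ℝ] E) := fun t => ContinuousLinearMap.id ℝ E - P t with hQ
  have hQx (t : ℝ) (x : E) : Q t x = x - P t x := by simp [hQ]
  have hPP' (t : ℝ) (ht : 1 ≤ t) (x : E) : P t (P t x) = P t x := DFunLike.congr_fun (hPP t ht) x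
  have hPc {t s : ℝ} (ht : 1 ≤ t) (hs : 1 ≤ s) (x : E) : P t (T t s x) = T t s (P s x) :=
    commute_evolution_of_forward hT (fun t s hs hst x => DFunLike.congr_fun (hPT t s hs hst) x)
      ht hs x
  have hQc {t s : ℝ} (ht : 1 ≤ t) (hs : 1 ≤ s) (x : E) : Q t (T t s x) = T t s (Q s x) := by
    rw [hQx, hQx, hPc ht hs, map_sub]
  have hPorb {t s : ℝ} (ht : 1 ≤ t) (hs : 1 ≤ s) (x : E) (τ : ℝ) (hτ : 1 ≤ τ) :
      T τ t (P t (T t s x)) = T τ s (P s x) := by rw [hPc ht hs, hT.2.1 τ t s hs ht hτ]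
  have hQorb {t s : ℝ} (ht : 1 ≤ t) (hs : 1 ≤ s) (x : E) (τ : ℝ) (hτ : 1 ≤ τ) :
      T τ t (Q t (T t s x)) = T τ s (Q s x) := by rw [hQc ht hs, hT.2.1 τ t s hs ht hτ]
  have hPn (t : ℝ) (ht : 1 ≤ t) : ‖P t‖ ≤ K * t ^ eps := by
    have h := (hest t t ht le_rfl).1
    rw [div_self (by positivity : t ≠ 0), Real.one_rpow, mul_one, hT.1 t ht] at h
    exact h
  have hQn (t : ℝ) (ht : 1 ≤ t) : ‖Q t‖ ≤ K * t ^ eps := by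
    have h := (hest t t ht le_rfl).2.1
    rw [div_self (by positivity : t ≠ 0), Real.one_rpow, mul_one, hT.1 t ht] at h
    exact h
  set wP : ℝ → ℝ → ℝ := fun τ t => minRpow lam a (τ / t) with hwP
  set wQ : ℝ → ℝ → ℝ := fun τ t => minRpow lam a (t / τ) with hwQ
  have hwP0 {t : ℝ} (ht : 1 ≤ t) (τ : ℝ) (hτ : 1 ≤ τ) : 0 ≤ wP τ t :=
    minRpow_nonneg (by positivity)
  have hwQ0 {t : ℝ} (ht : 1 ≤ t) (τ : ℝ) (hτ : 1 ≤ τ) : 0 ≤ wQ τ t :=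
    minRpow_nonneg (by positivity)
  have hbP {t : ℝ} (ht : 1 ≤ t) (τ : ℝ) (hτ : 1 ≤ τ) (x : E) :
      wP τ t * ‖T τ t (P t x)‖ ≤ (K + K ^ 2) * t ^ (2 * eps) * ‖x‖ := by
    rcases le_total t τ with h | h
    · exact weighted_norm_apply_le (M := (T τ t : E →L[ℝ] E).comp (P t)) (by positivity) ht hK
        heps (min_le_left _ _) (hest τ t ht h).1 x
    · refine weighted_norm_comp_apply_le (L := (T τ t : E →L[ℝ] E)) (B := P t) (by positivity)
        (by positivity) hK ?_ (hest t τ hτ h).2.2.2 (hPn t ht) x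
      rw [Real.rpow_neg (by positivity), ← Real.inv_rpow (by positivity), inv_div]
      exact min_le_right _ _
  have hbQ {t : ℝ} (ht : 1 ≤ t) (τ : ℝ) (hτ : 1 ≤ τ) (x : E) :
      wQ τ t * ‖T τ t (Q t x)‖ ≤ (K + K ^ 2) * t ^ (2 * eps) * ‖x‖ := by
    rcases le_total τ t with h | h
    · exact weighted_norm_apply_le (M := (T τ t : E →L[ℝ] E).comp (Q t)) (by positivity) ht hK
        heps (min_le_left _ _) (hest t τ hτ h).2.1 x
    · refine weighted_norm_comp_apply_le (L := (T τ t : E →L[ℝ] E)) (B := Q t) (by positivity)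
        (by positivity) hK ?_ (hest τ t ht h).2.2.1 (hQn t ht) x
      rw [Real.rpow_neg (by positivity), ← Real.inv_rpow (by positivity), inv_div]
      exact min_le_right _ _
  set NP := weightedOrbitSup T P wP with hNP
  set NQ := weightedOrbitSup T Q wQ with hNQ
  have hNP0 {t : ℝ} (ht : 1 ≤ t) (x : E) : 0 ≤ NP t x := weightedOrbitSup_nonneg (hwP0 ht)
  have hNQ0 {t : ℝ} (ht : 1 ≤ t) (x : E) : 0 ≤ NQ t x := weightedOrbitSup_nonneg (hwQ0 ht)
  have hlow {t : ℝ} (ht : 1 ≤ t) (x : E) : ‖x‖ ≤ NP t x + NQ t x := by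
    have h1 := le_weightedOrbitSup (fun τ hτ => hbP ht τ hτ x) ht
    have h2 := le_weightedOrbitSup (fun τ hτ => hbQ ht τ hτ x) ht
    simp only [hwP, hwQ, div_self (by positivity : t ≠ 0), minRpow_one, one_mul, hT.1 t ht,
      ContinuousLinearEquiv.coe_refl', id] at h1 h2
    calc ‖x‖ = ‖P t x + Q t x‖ := by rw [hQx]; congr 1; abel
      _ ≤ ‖P t x‖ + ‖Q t x‖ := norm_add_le _ _
      _ ≤ _ := add_le_add h1 h2
  have hup {t : ℝ} (ht : 1 ≤ t) (x : E) :
      NP t x + NQ t x ≤ 2 * (K + K ^ 2) * t ^ (2 * eps) * ‖x‖ := by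
    have h1 : NP t x ≤ _ := weightedOrbitSup_le fun τ hτ => hbP ht τ hτ x
    have h2 : NQ t x ≤ _ := weightedOrbitSup_le fun τ hτ => hbQ ht τ hτ x
    linarith
  have hPmap {t s c : ℝ} (ht : 1 ≤ t) (hs : 1 ≤ s) (hc : 0 ≤ c)
      (hw : ∀ τ, 1 ≤ τ → wP τ t ≤ c * wP τ s) (x : E) : NP t (T t s x) ≤ c * NP s x :=
    weightedOrbitSup_map_le (fun τ hτ => hbP hs τ hτ x) hc (hPorb ht hs x) hw
  have hQmap {t s c : ℝ} (ht : 1 ≤ t) (hs : 1 ≤ s) (hc : 0 ≤ c)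
      (hw : ∀ τ, 1 ≤ τ → wQ τ t ≤ c * wQ τ s) (x : E) : NQ t (T t s x) ≤ c * NQ s x :=
    weightedOrbitSup_map_le (fun τ hτ => hbQ hs τ hτ x) hc (hQorb ht hs x) hw
  refine ⟨fun t x => NP t x + NQ t x, fun t ht => ⟨fun x => ?_, fun x => ⟨fun h => ?_, ?_⟩,
    fun c x => ?_, fun x y => ?_⟩, ⟨1, lam, a, one_pos, hlam, hla, P, hPP, hPT, ?_⟩,
    2 * (K + K ^ 2), 2 * eps, by positivity, by positivity, fun t ht x => ⟨hlow ht x, hup ht x⟩⟩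
  · exact add_nonneg (hNP0 ht x) (hNQ0 ht x)
  · exact norm_le_zero_iff.1 ((hlow ht x).trans h.le)
  · rintro rfl
    simp [hNP, hNQ, weightedOrbitSup_eq_zero]
  · simp only [hNP, hNQ, weightedOrbitSup_smul, mul_add]
  · have h1 : NP t (x + y) ≤ NP t x + NP t y := weightedOrbitSup_add_le (hwP0 ht) (hbP ht)
    have h2 : NQ t (x + y) ≤ NQ t x + NQ t y := weightedOrbitSup_add_le (hwQ0 ht) (hbQ ht)
    linarith
  intro t s hs hst x
  have ht : 1 ≤ t := hs.trans hst
  have hs0 : 0 < s := by positivity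
  have ht0 : 0 < t := by positivity
  have hr1 : 1 ≤ t / s := (one_le_div hs0).2 hst
  have hc1 : s / t ≤ 1 := (div_le_one ht0).2 hst
  have hinv : (s / t) ^ lam = (t / s) ^ (-lam) := by
    rw [Real.rpow_neg (by positivity), ← Real.inv_rpow (by positivity), inv_div]
  have hla' : (t / s) ^ (-lam) ≤ (t / s) ^ a :=
    Real.rpow_le_rpow_of_exponent_le hr1 (by linarith)
  have hdec (y : E) : NP t (T t s y) ≤ (t / s) ^ (-lam) * NP s y := by
    refine hPmap ht hs (by positivity) (fun τ hτ => ?_) y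
    rw [← hinv]
    convert minRpow_mul_le_of_le_one hla (by positivity : 0 ≤ τ / s) (by positivity) hc1 using 2
    field_simp
  have hdec' (y : E) : NQ s (T s t y) ≤ (t / s) ^ (-lam) * NQ t y := by
    refine hQmap hs ht (by positivity) (fun τ hτ => ?_) y
    rw [← hinv]
    convert minRpow_mul_le_of_le_one hla (by positivity : 0 ≤ t / τ) (by positivity) hc1 using 2
    field_simp
  have hgrow : NP s (T s t x) ≤ (t / s) ^ a * NP t x := by
    refine hPmap hs ht (by positivity) (fun τ hτ => ?_) x
    convert minRpow_mul_le_of_one_le hla (by positivity : 0 ≤ τ / t) hr1 using 2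
    field_simp
  have hgrow' : NQ t (T t s x) ≤ (t / s) ^ a * NQ s x := by
    refine hQmap ht hs (by positivity) (fun τ hτ => ?_) x
    convert minRpow_mul_le_of_one_le hla (by positivity : 0 ≤ s / τ) hr1 using 2
    field_simp
  rw [one_mul, one_mul]
  refine ⟨?_, ?_, ?_, ?_⟩
  · have h0 : NQ t (T t s (P s x)) = 0 :=
      weightedOrbitSup_eq_zero (by rw [hQc ht hs, hQx, hPP' s hs, sub_self, map_zero])
    have h1 : NP s (P s x) = NP s x := weightedOrbitSup_congr (hPP' s hs x)
    have h2 := hdec (P s x)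
    rw [h1] at h2
    have h3 : 0 ≤ (t / s) ^ (-lam) * NQ s x := mul_nonneg (by positivity) (hNQ0 hs x)
    linarith
  · have hPQ : P t (x - P t x) = 0 := by rw [map_sub, hPP' t ht, sub_self]
    have h0 : NP s (T s t (x - P t x)) = 0 :=
      weightedOrbitSup_eq_zero (by rw [hPc hs ht, hPQ, map_zero])
    have h1 : NQ t (x - P t x) = NQ t x :=
      weightedOrbitSup_congr (by rw [hQx, hQx, hPQ, sub_zero])
    have h2 := hdec' (x - P t x)
    rw [h1] at h2
    have h3 : 0 ≤ (t / s) ^ (-lam) * NP t x := mul_nonneg (by positivity) (hNP0 ht x)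
    linarith
  · have h := mul_le_mul_of_nonneg_right hla' (hNP0 hs x)
    linarith [hdec x]
  · have h := mul_le_mul_of_nonneg_right hla' (hNQ0 ht x)
    linarith [hdec' x]

theorem nonuniform_of_exists_norms {T : ℝ → ℝ → (E ≃L[ℝ] E)} {N : ℝ → E → ℝ}
    (h : CStrongPolyDichotomyWRT T N) {C δ : ℝ} (hC : 0 < C) (hδ : 0 ≤ δ)
    (hN : ∀ t : ℝ, 1 ≤ t → ∀ x : E, ‖x‖ ≤ N t x ∧ N t x ≤ C * t ^ δ * ‖x‖) :
    CNonuniformStrongPolyDichotomy T := by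
  obtain ⟨K, lam, a, hK, hlam, hla, P, hPP, hPT, hest⟩ := h
  have key {u v k : ℝ} (hu : 1 ≤ u) (hv : 1 ≤ v) (hk : 0 ≤ k) (L : E →L[ℝ] E)
      (hL : ∀ x, N u (L x) ≤ K * k * N v x) : ‖L‖ ≤ K * C * k * v ^ δ := by
    refine L.opNorm_le_bound (by positivity) fun x => ?_
    calc ‖L x‖ ≤ N u (L x) := (hN u hu _).1
      _ ≤ K * k * N v x := hL x
      _ ≤ K * k * (C * v ^ δ * ‖x‖) := by gcongr; exact (hN v hv x).2
      _ = _ := by ring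
  refine ⟨δ, hδ, K * C, lam, a, by positivity, hlam, hla, P, hPP, hPT, fun t s hs hst => ?_⟩
  have ht : 1 ≤ t := hs.trans hst
  exact ⟨key ht hs (by positivity) _ fun x => (hest t s hs hst x).1,
    key hs ht (by positivity) _ fun x => by simpa using (hest t s hs hst x).2.1,
    key ht hs (by positivity) _ fun x => (hest t s hs hst x).2.2.1,
    key hs ht (by positivity) _ fun x => (hest t s hs hst x).2.2.2⟩

/-- Proposition: characterization of nonuniform strong polynomial
dichotomies for continuous time via families of norms. -/
theorem cNonuniformStrongPolyDichotomy_iff_exists_norms {d : ℕ}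
    (A : ℝ → (EuclideanSpace ℝ (Fin d) →L[ℝ] EuclideanSpace ℝ (Fin d)))
    (hA : ContinuousOn A (Set.Ici 1))
    (T : ℝ → ℝ → (EuclideanSpace ℝ (Fin d) ≃L[ℝ] EuclideanSpace ℝ (Fin d)))
    (hT : IsEvolutionFamily A T) :
    CNonuniformStrongPolyDichotomy T ↔
      ∃ N : ℝ → EuclideanSpace ℝ (Fin d) → ℝ,
        (∀ t : ℝ, 1 ≤ t → IsNormOn (N t)) ∧
        CStrongPolyDichotomyWRT T N ∧
        ∃ C δ : ℝ, 0 < C ∧ 0 ≤ δ ∧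
          ∀ t : ℝ, 1 ≤ t → ∀ x : EuclideanSpace ℝ (Fin d),
            ‖x‖ ≤ N t x ∧ N t x ≤ C * t ^ δ * ‖x‖ := by
  refine ⟨exists_norms_of_nonuniform hT, ?_⟩
  rintro ⟨N, -, hdich, C, δ, hC, hδ, hN⟩
  exact nonuniform_of_exists_norms hdich hC hδ hN

end NonautLin
end
end

section
/- Let A : [1,∞) → ℝ^{d×d} be continuous with evolution family T(t,s), and let (‖·‖_t)_{t≥1} be a family of norms on ℝ^d such that there exist K,a>0 with ‖T(t,s)x‖_t ≤ K(t/s)^a‖x‖_s and ‖T(s,t)x‖_s ≤ K(t/s)^a‖x‖_t for all t≥s≥1 and x∈ℝ^d. Define A_n := T(n+1,n) for n∈ℕ. Then the following are equivalent: (1) the equation x'=A(t)x admits a strong polynomial dichotomy with respect to the family of norms (‖·‖_t)_{t≥1}; (2) the sequence (A_n)_{n∈ℕ} admits a strong polynomial dichotomy with respect to the sequence of norms (‖·‖_n)_{n∈ℕ}. -/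
noncomputable section

namespace NonautLin

variable {E : Type*} [NormedAddCommGroup E] [NormedSpace ℝ E]

/-- `fwd A n k` is the composition `A (n+k-1) ∘ ⋯ ∘ A n`. -/
def fwd (A : ℕ → (E ≃L[ℝ] E)) (n : ℕ) : ℕ → (E ≃L[ℝ] E)
  | 0 => ContinuousLinearEquiv.refl ℝ E
  | k + 1 => (fwd A n k).trans (A (n + k))

/-- The cocycle `𝒜(m,n)` associated with the one-sided sequence `A`:
`𝒜(m,n) = A (m-1) ∘ ⋯ ∘ A n` for `m > n`, `𝒜(n,n) = Id`, and
`𝒜(m,n) = (𝒜(n,m))⁻¹` for `m < n`. -/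
def coc (A : ℕ → (E ≃L[ℝ] E)) (m n : ℕ) : E ≃L[ℝ] E :=
  if n ≤ m then fwd A n (m - n) else (fwd A m (n - m)).symm

/-- Nonuniform strong polynomial dichotomy (indices `n ≥ 1`), with nonuniformity
exponent `eps`. -/
def NonuniformStrongPolyDichotomyWith (A : ℕ → (E ≃L[ℝ] E)) (eps : ℝ) : Prop :=
  ∃ K lam a : ℝ, 0 < K ∧ 0 < lam ∧ lam ≤ a ∧
    ∃ P : ℕ → (E →L[ℝ] E),
      (∀ n, 1 ≤ n → (P n).comp (P n) = P n) ∧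
      (∀ n, 1 ≤ n → ((A n : E →L[ℝ] E)).comp (P n) = (P (n + 1)).comp (A n : E →L[ℝ] E)) ∧
      (∀ m n : ℕ, 1 ≤ n → n ≤ m →
        ‖((coc A m n : E →L[ℝ] E)).comp (P n)‖ ≤ K * ((m : ℝ) / n) ^ (-lam) * (n : ℝ) ^ eps ∧
        ‖((coc A n m : E →L[ℝ] E)).comp (ContinuousLinearMap.id ℝ E - P m)‖
          ≤ K * ((m : ℝ) / n) ^ (-lam) * (m : ℝ) ^ eps ∧
        ‖(coc A m n : E →L[ℝ] E)‖ ≤ K * ((m : ℝ) / n) ^ a * (n : ℝ) ^ eps ∧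
        ‖(coc A n m : E →L[ℝ] E)‖ ≤ K * ((m : ℝ) / n) ^ a * (m : ℝ) ^ eps)

/-- Nonuniform strong polynomial dichotomy (indices `n ≥ 1`). -/
def NonuniformStrongPolyDichotomy (A : ℕ → (E ≃L[ℝ] E)) : Prop :=
  ∃ eps : ℝ, 0 ≤ eps ∧ NonuniformStrongPolyDichotomyWith A eps

/-- Strong polynomial dichotomy with respect to a sequence of norms (indices `n ≥ 1`). -/
def StrongPolyDichotomyWRT (A : ℕ → (E ≃L[ℝ] E)) (N : ℕ → E → ℝ) : Prop :=
  ∃ K lam a : ℝ, 0 < K ∧ 0 < lam ∧ lam ≤ a ∧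
    ∃ P : ℕ → (E →L[ℝ] E),
      (∀ n, 1 ≤ n → (P n).comp (P n) = P n) ∧
      (∀ n, 1 ≤ n → ((A n : E →L[ℝ] E)).comp (P n) = (P (n + 1)).comp (A n : E →L[ℝ] E)) ∧
      (∀ m n : ℕ, 1 ≤ n → n ≤ m → ∀ x : E,
        N m (coc A m n (P n x)) ≤ K * ((m : ℝ) / n) ^ (-lam) * N n x ∧
        N n (coc A n m (x - P m x)) ≤ K * ((m : ℝ) / n) ^ (-lam) * N m x ∧
        N m (coc A m n x) ≤ K * ((m : ℝ) / n) ^ a * N n x ∧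
        N n (coc A n m x) ≤ K * ((m : ℝ) / n) ^ a * N m x)

section EvolutionFamily

variable {E : Type*} [NormedAddCommGroup E] [NormedSpace ℝ E]

theorem coc_eq_of_cocycle {T : ℝ → ℝ → (E ≃L[ℝ] E)}
    (hid : ∀ s : ℝ, 1 ≤ s → T s s = ContinuousLinearEquiv.refl ℝ E)
    (hcomp : ∀ t r s : ℝ, 1 ≤ s → 1 ≤ r → 1 ≤ t → ∀ x : E, T t r (T r s x) = T t s x)
    {m n : ℕ} (hm : 1 ≤ m) (hn : 1 ≤ n) :
    coc (fun n : ℕ => T ((n : ℝ) + 1) (n : ℝ)) m n = T m n := by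
  have hfwd : ∀ n : ℕ, 1 ≤ n → ∀ k : ℕ, ∀ x : E,
      fwd (fun n : ℕ => T ((n : ℝ) + 1) (n : ℝ)) n k x = T ((n + k : ℕ) : ℝ) n x := by
    intro n hn k x
    have hn' : (1 : ℝ) ≤ n := by exact_mod_cast hn
    induction k with
    | zero => simp [fwd, hid _ hn']
    | succ k ih =>
      have hk : (0 : ℝ) ≤ k := k.cast_nonneg
      simp only [fwd, ContinuousLinearEquiv.trans_apply, ih]
      rw [hcomp _ _ _ hn' (by push_cast; linarith) (by push_cast; linarith)]
      push_cast
      rw [add_assoc]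
  have hm' : (1 : ℝ) ≤ m := by exact_mod_cast hm
  have hn' : (1 : ℝ) ≤ n := by exact_mod_cast hn
  ext x
  unfold coc
  split_ifs with h
  · rw [hfwd n hn, Nat.add_sub_cancel' h]
  · rw [ContinuousLinearEquiv.symm_apply_eq, hfwd m hm, Nat.add_sub_cancel' (by omega),
      hcomp _ _ _ hn' hm' hn', hid _ hn']
    rfl

theorem StrongPolyDichotomyWRT.of_continuous {T : ℝ → ℝ → (E ≃L[ℝ] E)} {N : ℝ → E → ℝ}
    (hid : ∀ s : ℝ, 1 ≤ s → T s s = ContinuousLinearEquiv.refl ℝ E)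
    (hcomp : ∀ t r s : ℝ, 1 ≤ s → 1 ≤ r → 1 ≤ t → ∀ x : E, T t r (T r s x) = T t s x)
    (h : CStrongPolyDichotomyWRT T N) :
    StrongPolyDichotomyWRT (fun n : ℕ => T ((n : ℝ) + 1) (n : ℝ)) (fun n : ℕ => N (n : ℝ)) := by
  obtain ⟨K, lam, a, hK, hlam, hla, P, hP, hPT, hb⟩ := h
  refine ⟨K, lam, a, hK, hlam, hla, fun n => P n, fun n hn => hP n (by exact_mod_cast hn),
    fun n hn => ?_, fun m n hn hnm x => ?_⟩
  · simpa using (hPT ((n : ℝ) + 1) n (by exact_mod_cast hn) (by linarith)).symm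
  · rw [coc_eq_of_cocycle hid hcomp (hn.trans hnm) hn,
      coc_eq_of_cocycle hid hcomp hn (hn.trans hnm)]
    exact hb m n (by exact_mod_cast hn) (by exact_mod_cast hnm) x

theorem div_floor_le_two {t : ℝ} (ht : 1 ≤ t) : t / (⌊t⌋₊ : ℝ) ≤ 2 := by
  have h1 : (1 : ℝ) ≤ ⌊t⌋₊ := by exact_mod_cast (Nat.one_le_floor_iff t).2 ht
  rw [div_le_iff₀ (by linarith)]
  linarith [Nat.lt_floor_add_one t]

theorem floor_div_floor_rpow_neg_le {s t lam : ℝ} (hs : 1 ≤ s) (hst : s ≤ t) (hlam : 0 ≤ lam) :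
    ((⌊t⌋₊ : ℝ) / ⌊s⌋₊) ^ (-lam) ≤ 2 ^ lam * (t / s) ^ (-lam) := by
  have ht := hs.trans hst
  have hm : (1 : ℝ) ≤ ⌊t⌋₊ := by exact_mod_cast (Nat.one_le_floor_iff t).2 ht
  have hn : (1 : ℝ) ≤ ⌊s⌋₊ := by exact_mod_cast (Nat.one_le_floor_iff s).2 hs
  have hns : (⌊s⌋₊ : ℝ) ≤ s := Nat.floor_le (by linarith)
  have hle : t / s / 2 ≤ (⌊t⌋₊ : ℝ) / ⌊s⌋₊ := by
    have : t / 2 ≤ (⌊t⌋₊ : ℝ) := by linarith [Nat.lt_floor_add_one t]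
    calc t / s / 2 = t / 2 / s := by ring
      _ ≤ (⌊t⌋₊ : ℝ) / ⌊s⌋₊ := by gcongr
  have hpos : 0 < t / s := div_pos (by linarith) (by linarith)
  calc ((⌊t⌋₊ : ℝ) / ⌊s⌋₊) ^ (-lam) ≤ (t / s / 2) ^ (-lam) :=
        Real.rpow_le_rpow_of_nonpos (by positivity) hle (by linarith)
    _ = 2 ^ lam * (t / s) ^ (-lam) := by
        rw [Real.div_rpow hpos.le zero_le_two, Real.rpow_neg zero_le_two lam, div_inv_eq_mul,
          mul_comm]

theorem CStrongPolyDichotomyWRT.of_discretization {T : ℝ → ℝ → (E ≃L[ℝ] E)} {N : ℝ → E → ℝ}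
    (hid : ∀ s : ℝ, 1 ≤ s → T s s = ContinuousLinearEquiv.refl ℝ E)
    (hcomp : ∀ t r s : ℝ, 1 ≤ s → 1 ≤ r → 1 ≤ t → ∀ x : E, T t r (T r s x) = T t s x)
    (hN : ∀ t : ℝ, 1 ≤ t → ∀ x, 0 ≤ N t x) {K a : ℝ} (hK : 0 < K) (ha : 0 < a)
    (hbg : ∀ t s : ℝ, 1 ≤ s → s ≤ t → ∀ x : E,
      N t (T t s x) ≤ K * (t / s) ^ a * N s x ∧ N s (T s t x) ≤ K * (t / s) ^ a * N t x)
    (h : StrongPolyDichotomyWRT (fun n : ℕ => T ((n : ℝ) + 1) (n : ℝ))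
      (fun n : ℕ => N (n : ℝ))) :
    CStrongPolyDichotomyWRT T N := by
  obtain ⟨K', lam, a', hK', hlam, -, P, hP, hPT, hb⟩ := h
  have h11 : (1 : ℝ) ≤ 1 := le_rfl
  let Q : ℝ → (E →L[ℝ] E) := fun t => ((T t 1 : E →L[ℝ] E).comp (P 1)).comp (T 1 t : E →L[ℝ] E)
  have hQ : ∀ t x, Q t x = T t 1 (P 1 (T 1 t x)) := fun _ _ => rfl
  have hQT : ∀ t s : ℝ, 1 ≤ t → 1 ≤ s → ∀ x, Q t (T t s x) = T t s (Q s x) := by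
    intro t s ht hs x
    rw [hQ, hQ, hcomp _ _ _ hs ht h11, hcomp _ _ _ h11 hs ht]
  have hQP : ∀ n : ℕ, 1 ≤ n → ∀ x, Q n x = P n x := by
    intro n hn
    induction n, hn using Nat.le_induction with
    | base => intro x; simp [hQ, hid 1 h11]
    | succ n hn ih =>
      intro x
      have hn' : (1 : ℝ) ≤ n := by exact_mod_cast hn
      have hn1 : (1 : ℝ) ≤ (n : ℝ) + 1 := by linarith
      obtain ⟨y, rfl⟩ := (T ((n : ℝ) + 1) n).surjective x
      have := DFunLike.congr_fun (hPT n hn) y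
      simp only [ContinuousLinearMap.comp_apply, ContinuousLinearEquiv.coe_coe] at this
      rw [← this, ← ih]
      push_cast
      exact hQT _ _ hn1 hn' y
  set c : ℝ := K * 2 ^ a with hc
  have hcpos : 0 < c := by positivity
  have hfl : ∀ t : ℝ, 1 ≤ t → (1 : ℝ) ≤ ⌊t⌋₊ := fun t ht => by
    exact_mod_cast (Nat.one_le_floor_iff t).2 ht
  have hcb : ∀ t : ℝ, 1 ≤ t → ∀ x, N t (T t ⌊t⌋₊ x) ≤ c * N ⌊t⌋₊ x ∧
      N ⌊t⌋₊ (T ⌊t⌋₊ t x) ≤ c * N t x := by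
    intro t ht x
    have hm := hfl t ht
    have hle : K * (t / (⌊t⌋₊ : ℝ)) ^ a ≤ c := by
      rw [hc]
      have := div_floor_le_two ht
      gcongr
    obtain ⟨h1, h2⟩ := hbg t ⌊t⌋₊ hm (Nat.floor_le (by linarith)) x
    exact ⟨h1.trans (mul_le_mul_of_nonneg_right hle (hN _ hm _)),
      h2.trans (mul_le_mul_of_nonneg_right hle (hN _ ht _))⟩
  have hb' : ∀ t s : ℝ, 1 ≤ s → s ≤ t → ∀ x : E,
      N t (T t s (Q s x)) ≤ c * (K' * 2 ^ lam) * c * (t / s) ^ (-lam) * N s x ∧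
      N s (T s t (x - Q t x)) ≤ c * (K' * 2 ^ lam) * c * (t / s) ^ (-lam) * N t x := by
    intro t s hs hst x
    have ht := hs.trans hst
    have hm := hfl t ht
    have hn := hfl s hs
    have hn' : 1 ≤ ⌊s⌋₊ := by exact_mod_cast hn
    have hm' : 1 ≤ ⌊t⌋₊ := by exact_mod_cast hm
    have hrate := floor_div_floor_rpow_neg_le hs hst hlam.le
    have hpos : 0 < t / s := div_pos (by linarith) (by linarith)
    have hb₁ := fun y => (hb ⌊t⌋₊ ⌊s⌋₊ hn' (Nat.floor_mono hst) y).1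
    have hb₂ := fun y => (hb ⌊t⌋₊ ⌊s⌋₊ hn' (Nat.floor_mono hst) y).2.1
    rw [coc_eq_of_cocycle hid hcomp hm' hn'] at hb₁
    rw [coc_eq_of_cocycle hid hcomp hn' hm'] at hb₂
    constructor
    · have heq : T t s (Q s x) = T t ⌊t⌋₊ (T ⌊t⌋₊ ⌊s⌋₊ (P ⌊s⌋₊ (T ⌊s⌋₊ s x))) := by
        rw [← hQP _ hn', hQT _ _ hn hs, hcomp _ _ _ hs hn hm, hcomp _ _ _ hs hm ht]
      rw [heq]
      have hNs := hN s hs x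
      have hNn := hN ⌊s⌋₊ hn (T ⌊s⌋₊ s x)
      calc _ ≤ c * N ⌊t⌋₊ (T ⌊t⌋₊ ⌊s⌋₊ (P ⌊s⌋₊ (T ⌊s⌋₊ s x))) := (hcb t ht _).1
        _ ≤ c * (K' * (2 ^ lam * (t / s) ^ (-lam)) * (c * N s x)) := by
            gcongr
            refine (hb₁ _).trans ?_
            gcongr
            exact (hcb s hs x).2
        _ = _ := by ring
    · have heq : T s t (x - Q t x) = T s ⌊s⌋₊ (T ⌊s⌋₊ ⌊t⌋₊
          (T ⌊t⌋₊ t x - P ⌊t⌋₊ (T ⌊t⌋₊ t x))) := by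
        rw [← hQP _ hm', hQT _ _ hm ht, ← map_sub, hcomp _ _ _ ht hm hn, hcomp _ _ _ ht hn hs]
      rw [heq]
      have hNt := hN t ht x
      have hNm := hN ⌊t⌋₊ hm (T ⌊t⌋₊ t x)
      calc _ ≤ c * N ⌊s⌋₊ (T ⌊s⌋₊ ⌊t⌋₊ (T ⌊t⌋₊ t x - P ⌊t⌋₊ (T ⌊t⌋₊ t x))) := (hcb s hs _).1
        _ ≤ c * (K' * (2 ^ lam * (t / s) ^ (-lam)) * (c * N t x)) := by
            gcongr
            refine (hb₂ _).trans ?_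
            gcongr
            exact (hcb t ht x).2
        _ = _ := by ring
  refine ⟨max (c * (K' * 2 ^ lam) * c) K, lam, max lam a, lt_max_of_lt_right hK, hlam,
    le_max_left _ _, Q, fun t ht => ?_, fun t s hs hst => ?_, fun t s hs hst x => ?_⟩
  · ext1 x
    have hPP := DFunLike.congr_fun (hP 1 le_rfl) (T 1 t x)
    rw [ContinuousLinearMap.comp_apply] at hPP ⊢
    rw [hQ t x, hQT _ _ ht h11, hQ 1]
    simp [hid 1 h11, hPP]
  · ext1 x
    exact hQT t s (hs.trans hst) hs x
  · have ht := hs.trans hst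
    have hone : 1 ≤ t / s := (one_le_div (by linarith)).2 hst
    have hNs := hN s hs x
    have hNt := hN t ht x
    obtain ⟨h1, h2⟩ := hb' t s hs hst x
    obtain ⟨h3, h4⟩ := hbg t s hs hst x
    refine ⟨h1.trans ?_, h2.trans ?_, h3.trans ?_, h4.trans ?_⟩ <;> gcongr <;>
      first | exact le_max_left _ _ | exact le_max_right _ _

end EvolutionFamily

/-- Proposition: equivalence of continuous-time polynomial dichotomy
and polynomial dichotomy of the discretized system `A_n = T(n+1, n)`. -/
theorem cStrongPolyDichotomyWRT_iff_discretization {d : ℕ}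
    (A : ℝ → (EuclideanSpace ℝ (Fin d) →L[ℝ] EuclideanSpace ℝ (Fin d)))
    (hA : ContinuousOn A (Set.Ici 1))
    (T : ℝ → ℝ → (EuclideanSpace ℝ (Fin d) ≃L[ℝ] EuclideanSpace ℝ (Fin d)))
    (hT : IsEvolutionFamily A T)
    (N : ℝ → EuclideanSpace ℝ (Fin d) → ℝ)
    (hN : ∀ t : ℝ, 1 ≤ t → IsNormOn (N t))
    (K a : ℝ) (hK : 0 < K) (ha : 0 < a)
    (hbg : ∀ t s : ℝ, 1 ≤ s → s ≤ t → ∀ x : EuclideanSpace ℝ (Fin d),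
      N t (T t s x) ≤ K * (t / s) ^ a * N s x ∧
      N s (T s t x) ≤ K * (t / s) ^ a * N t x) :
    CStrongPolyDichotomyWRT T N ↔
      StrongPolyDichotomyWRT (fun n : ℕ => T ((n : ℝ) + 1) (n : ℝ))
        (fun n : ℕ => N (n : ℝ)) := by
  have hN0 : ∀ t : ℝ, 1 ≤ t → ∀ x, 0 ≤ N t x := fun t ht => (hN t ht).1
  exact ⟨StrongPolyDichotomyWRT.of_continuous hT.1 hT.2.1,
    CStrongPolyDichotomyWRT.of_discretization hT.1 hT.2.1 hN0 hK ha hbg⟩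

end NonautLin
end
end

section
/- Let A : [1,∞) → ℝ^{d×d} be continuous with evolution family T(t,s), and let 𝒮 = (‖·‖_t)_{t≥1} be a family of norms on ℝ^d such that there exist K,a>0 with ‖T(t,s)x‖_t ≤ K(t/s)^a‖x‖_s and ‖T(s,t)x‖_s ≤ K(t/s)^a‖x‖_t for all t≥s≥1 and x∈ℝ^d. Let 𝔸 = (A_n)_{n∈ℕ} with A_n := T(n+1,n) and 𝒮′ = (‖·‖_n)_{n∈ℕ}. Then Σ_{PD,A(·),𝒮} = Σ_{PD,𝔸,𝒮′}. In particular, there exist an integer r with 1≤r≤d and reals a_1≤b_1<a_2≤···<a_r≤b_r with 0<a_1 such that Σ_{PD,A(·),𝒮} = ⋃_{i=1}^r [log a_i/log 2, log b_i/log 2]. -/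
noncomputable section

namespace NonautLin

variable {E : Type*} [NormedAddCommGroup E] [NormedSpace ℝ E]

/-- The polynomial dichotomy spectrum: the set of `τ ∈ ℝ` such that
`(((n+1)/n)^{-τ} A_n)` does not admit a strong polynomial dichotomy w.r.t. `N`. -/
def SigmaPD (A : ℕ → (E ≃L[ℝ] E)) (N : ℕ → E → ℝ) : Set ℝ :=
  {τ | ¬ StrongPolyDichotomyWRT (fun n => scale ((((n : ℝ) + 1) / n) ^ (-τ)) (A n)) N}

theorem exists_Icc_decomposition_Iic {S : Set ℝ} {f : ℝ → ℕ} {d : ℕ}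
    (hd : ∀ x, f x ≤ d) (hmono : Monotone f)
    (hloc : ∀ x, x ∉ S → ∃ δ > 0, ∀ y, |y - x| < δ → y ∉ S ∧ f y = f x)
    (hconn : ∀ x y z, x ∉ S → z ∉ S → f x = f z → x ≤ y → y ≤ z → y ∉ S)
    (hlow : ∃ L, ∀ x ≤ L, x ∉ S ∧ f x = 0) (k : ℕ) :
    ∀ U, U ∉ S → f U = k →
      ∃ r : ℕ, r ≤ k ∧ (k ≠ 0 → 1 ≤ r) ∧ ∃ α β : ℕ → ℝ,
        (∀ i, 1 ≤ i → i ≤ r → α i ≤ β i ∧ β i < U) ∧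
        (∀ i, 1 ≤ i → i < r → β i < α (i + 1)) ∧
        ∀ x ≤ U, x ∈ S ↔ ∃ i, 1 ≤ i ∧ i ≤ r ∧ α i ≤ x ∧ x ≤ β i := by
  induction k using Nat.strong_induction_on with
  | _ k ih =>
  intro U hU hfU
  obtain ⟨L, hL⟩ := hlow
  rcases Nat.eq_zero_or_pos k with hk | hk
  · subst hk
    refine ⟨0, le_rfl, fun h => absurd rfl h, 0, 0, fun i _ _ => by omega,
      fun i _ _ => by omega, fun x hx => ⟨fun hxS => ?_, fun ⟨i, _, _, _⟩ => by omega⟩⟩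
    have hm := hL (min L U) (min_le_left _ _)
    rcases le_total x (min L U) with h | h
    · exact absurd hxS (hL x (h.trans (min_le_left _ _))).1
    · exact absurd hxS (hconn _ _ _ hm.1 hU (hm.2.trans hfU.symm) h hx)
  -- the top gap is `(b, U]`
  set B : Set ℝ := {x | x ∉ S ∧ f x = k} with hB
  have hBne : B.Nonempty := ⟨U, hU, hfU⟩
  have hBL : ∀ x ∈ B, L ≤ x := fun x hx => by
    by_contra hlt
    have := (hL x (not_le.1 hlt).le).2
    have := hx.2
    omega
  have hBbdd : BddBelow B := ⟨L, fun x hx => hBL x hx⟩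
  set b := sInf B with hb
  have hLb : L ≤ b := le_csInf hBne fun x hx => hBL x hx
  have hbS : b ∈ S := by
    by_contra hbS
    obtain ⟨δ, hδ, h⟩ := hloc b hbS
    obtain ⟨y, hy, hyb⟩ := exists_lt_of_csInf_lt hBne (show sInf B < b + δ by linarith)
    have hby : b ≤ y := csInf_le hBbdd hy
    have hfb : f b = k := by
      rw [← (h y (by rw [abs_of_nonneg (by linarith)]; linarith)).2]; exact hy.2
    have hz := h (b - δ / 2) (by rw [abs_lt]; constructor <;> linarith)
    have := csInf_le hBbdd (show b - δ / 2 ∈ B from ⟨hz.1, hz.2.trans hfb⟩)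
    linarith
  have hgap : ∀ x, b < x → x ≤ U → x ∉ S := by
    intro x hbx hxU
    obtain ⟨y, hy, hyx⟩ := exists_lt_of_csInf_lt hBne hbx
    exact hconn _ _ _ hy.1 hU (hy.2.trans hfU.symm) hyx.le hxU
  have hbU : b < U := lt_of_le_of_ne (csInf_le hBbdd ⟨hU, hfU⟩) fun h => hU (h ▸ hbS)
  -- the next gap has the largest value of `f` attained outside `S` below `b`
  have hVne : ∃ n, ∃ x, x ∉ S ∧ x < b ∧ f x = n :=
    ⟨0, L - 1, (hL _ (by linarith)).1, by linarith, (hL _ (by linarith)).2⟩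
  obtain ⟨k', ⟨U', hU'S, hU'b, hfU'⟩, hmax⟩ :
      ∃ n, (∃ x, x ∉ S ∧ x < b ∧ f x = n) ∧ ∀ x, x ∉ S → x < b → f x ≤ n := by
    classical
    have hex : ∃ n ≤ d, ∃ x, x ∉ S ∧ x < b ∧ f x = n := by
      obtain ⟨n, x, h1, h2, h3⟩ := hVne
      exact ⟨n, h3 ▸ hd x, x, h1, h2, h3⟩
    obtain ⟨n, hn, hx⟩ := hex
    refine ⟨Nat.findGreatest (fun n => ∃ x, x ∉ S ∧ x < b ∧ f x = n) d,
      Nat.findGreatest_spec (P := fun n => ∃ x, x ∉ S ∧ x < b ∧ f x = n) hn hx,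
      fun x h1 h2 => Nat.le_findGreatest (hd x) ⟨x, h1, h2, rfl⟩⟩
  have hk' : k' < k := by
    have h1 : k' ≤ k := by rw [← hfU', ← hfU]; exact hmono (by linarith)
    refine lt_of_le_of_ne h1 fun h => ?_
    have := csInf_le hBbdd (show U' ∈ B from ⟨hU'S, hfU'.trans h⟩)
    linarith
  set G : Set ℝ := {x | x ∉ S ∧ f x = k' ∧ x < b} with hG
  have hGne : G.Nonempty := ⟨U', hU'S, hfU', hU'b⟩
  have hGbdd : BddAbove G := ⟨b, fun x hx => hx.2.2.le⟩
  set c := sSup G with hc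
  have hcb : c ≤ b := csSup_le hGne fun x hx => hx.2.2.le
  have hcS : c ∈ S := by
    by_contra hcS
    have hcb' : c < b := lt_of_le_of_ne hcb fun h => hcS (h ▸ hbS)
    obtain ⟨δ, hδ, h⟩ := hloc c hcS
    obtain ⟨y, hy, hyc⟩ := exists_lt_of_lt_csSup hGne (show c - δ < sSup G by linarith)
    have hyc' : y ≤ c := le_csSup hGbdd hy
    have hfc : f c = k' := by
      rw [← (h y (by rw [abs_lt]; constructor <;> linarith)).2]; exact hy.2.1
    have hpos : 0 < min (δ / 2) ((b - c) / 2) := lt_min (by linarith) (by linarith)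
    have hm1 := min_le_left (δ / 2) ((b - c) / 2)
    have hm2 := min_le_right (δ / 2) ((b - c) / 2)
    have hz := h (c + min (δ / 2) ((b - c) / 2)) (by rw [abs_lt]; constructor <;> linarith)
    have := le_csSup hGbdd (show c + min (δ / 2) ((b - c) / 2) ∈ G from
      ⟨hz.1, hz.2.trans hfc, by linarith⟩)
    linarith
  have hU'c : U' < c := lt_of_le_of_ne (le_csSup hGbdd ⟨hU'S, hfU', hU'b⟩)
    fun h => hU'S (h ▸ hcS)
  have hband : ∀ x, c ≤ x → x ≤ b → x ∈ S := by
    intro x hcx hxb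
    by_contra hxS
    have hxb' : x < b := lt_of_le_of_ne hxb fun h => hxS (h ▸ hbS)
    have hcx' : c < x := lt_of_le_of_ne hcx fun h => hxS (h ▸ hcS)
    have h1 := hmax x hxS hxb'
    have h2 : k' ≤ f x := by rw [← hfU']; exact hmono (by linarith)
    have := le_csSup hGbdd (show x ∈ G from ⟨hxS, le_antisymm h1 h2, hxb'⟩)
    linarith
  have hgap' : ∀ x, U' ≤ x → x < c → x ∉ S := by
    intro x hx hxc
    obtain ⟨y, hy, hxy⟩ := exists_lt_of_lt_csSup hGne hxc
    exact hconn _ _ _ hU'S hy.1 (hfU'.trans hy.2.1.symm) hx hxy.le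
  obtain ⟨r, hr, -, α, β, h1, h2, h3⟩ := ih k' hk' U' hU'S hfU'
  refine ⟨r + 1, by omega, fun _ => by omega, fun i => if i = r + 1 then c else α i,
    fun i => if i = r + 1 then b else β i, ?_, ?_, ?_⟩
  · intro i hi hir
    by_cases h : i = r + 1
    · simp only [h, if_true]; exact ⟨hcb, hbU⟩
    · simp only [h, if_false]
      have := h1 i hi (by omega)
      exact ⟨this.1, by linarith⟩
  · intro i hi hir
    have hne : i ≠ r + 1 := by omega
    simp only [hne, if_false]
    by_cases h : i + 1 = r + 1
    · simp only [h, if_true]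
      have := (h1 i hi (by omega)).2
      linarith
    · simp only [h, if_false]
      exact h2 i hi (by omega)
  · intro x hx
    constructor
    · intro hxS
      rcases le_or_gt x U' with hxU' | hxU'
      · obtain ⟨i, hi, hir, hix⟩ := (h3 x hxU').1 hxS
        have hne : i ≠ r + 1 := by omega
        exact ⟨i, hi, by omega, by simpa only [hne, if_false] using hix⟩
      · refine ⟨r + 1, by omega, le_rfl, ?_⟩
        simp only [if_true]
        constructor
        · by_contra hlt
          exact hgap' x hxU'.le (not_le.1 hlt) hxS
        · by_contra hlt
          exact hgap x (not_le.1 hlt) hx hxS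
    · rintro ⟨i, hi, hir, hix⟩
      by_cases h : i = r + 1
      · simp only [h, if_true] at hix
        exact hband x hix.1 hix.2
      · simp only [h, if_false] at hix
        have := (h1 i hi (by omega)).2
        exact (h3 x (by linarith)).2 ⟨i, hi, by omega, hix⟩

theorem exists_Icc_decomposition {S : Set ℝ} {f : ℝ → ℕ} {d : ℕ} (hd1 : 1 ≤ d)
    (hd : ∀ x, f x ≤ d) (hmono : Monotone f)
    (hloc : ∀ x, x ∉ S → ∃ δ > 0, ∀ y, |y - x| < δ → y ∉ S ∧ f y = f x)
    (hconn : ∀ x y z, x ∉ S → z ∉ S → f x = f z → x ≤ y → y ≤ z → y ∉ S)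
    (hlow : ∃ L, ∀ x ≤ L, x ∉ S ∧ f x = 0) (hhigh : ∃ H, ∀ x ≥ H, x ∉ S ∧ f x = d) :
    ∃ r : ℕ, 1 ≤ r ∧ r ≤ d ∧ ∃ α β : ℕ → ℝ,
      (∀ i, 1 ≤ i → i ≤ r → α i ≤ β i) ∧
      (∀ i, 1 ≤ i → i < r → β i < α (i + 1)) ∧
      S = ⋃ i ∈ Finset.Icc 1 r, Set.Icc (α i) (β i) := by
  obtain ⟨H, hH⟩ := hhigh
  obtain ⟨r, hr, hr1, α, β, h1, h2, h3⟩ :=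
    exists_Icc_decomposition_Iic hd hmono hloc hconn hlow d H (hH H le_rfl).1 (hH H le_rfl).2
  refine ⟨r, hr1 (by omega), hr, α, β, fun i hi hir => (h1 i hi hir).1, h2, ?_⟩
  ext x
  simp only [Set.mem_iUnion, Finset.mem_Icc, Set.mem_Icc, exists_prop]
  rcases le_total x H with hx | hx
  · rw [h3 x hx]
    simp only [and_assoc]
  · refine ⟨fun h => absurd h (hH x hx).1, ?_⟩
    rintro ⟨i, ⟨hi, hir⟩, -, hxi⟩
    have := (h1 i hi hir).2
    linarith

/-- The algebraic properties of an evolution family on `[1,∞)`. -/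
structure IsCocycle (T : ℝ → ℝ → (E ≃L[ℝ] E)) : Prop where
  refl : ∀ s : ℝ, 1 ≤ s → ∀ x : E, T s s x = x
  comp : ∀ t r s : ℝ, 1 ≤ s → 1 ≤ r → 1 ≤ t → ∀ x : E, T t r (T r s x) = T t s x

/-- Polynomially bounded growth of `T` with respect to the norms `N`. -/
def HasPolyGrowth (T : ℝ → ℝ → (E ≃L[ℝ] E)) (N : ℝ → E → ℝ) (K a : ℝ) : Prop :=
  ∀ t s : ℝ, 1 ≤ s → s ≤ t → ∀ x : E,
    N t (T t s x) ≤ K * (t / s) ^ a * N s x ∧ N s (T s t x) ≤ K * (t / s) ^ a * N t x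

/-- The evolution family of the shifted equation. -/
def shift (T : ℝ → ℝ → (E ≃L[ℝ] E)) (τ t s : ℝ) : E ≃L[ℝ] E := scale ((t / s) ^ (-τ)) (T t s)

/-- A polynomial dichotomy of `x' = (A(t) - (τ/t) Id) x`, in terms of the evolution family `T`
of `x' = A(t)x`. -/
def HasPolyDichotomyAt (T : ℝ → ℝ → (E ≃L[ℝ] E)) (N : ℝ → E → ℝ) (τ K lam : ℝ)
    (P : ℝ → (E →L[ℝ] E)) : Prop :=
  (∀ t : ℝ, 1 ≤ t → (P t).comp (P t) = P t) ∧
  (∀ t s : ℝ, 1 ≤ s → s ≤ t → ∀ x, P t (T t s x) = T t s (P s x)) ∧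
  (∀ t s : ℝ, 1 ≤ s → s ≤ t → ∀ x : E,
    N t (T t s (P s x)) ≤ K * (t / s) ^ (τ + -lam) * N s x ∧
    N s (T s t (x - P t x)) ≤ K * (t / s) ^ (-τ + -lam) * N t x)

theorem scale_apply {c : ℝ} (hc : c ≠ 0) (A : E ≃L[ℝ] E) (x : E) : scale c A x = c • A x := by
  simp only [scale, smulCLE, hc, dif_neg, not_false_eq_true, ContinuousLinearEquiv.trans_apply]
  rfl

theorem shift_apply (T : ℝ → ℝ → (E ≃L[ℝ] E)) (τ : ℝ) {t s : ℝ} (ht : 1 ≤ t) (hs : 1 ≤ s)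
    (x : E) : shift T τ t s x = (t / s) ^ (-τ) • T t s x :=
  scale_apply (by positivity) _ _

theorem IsCocycle.shift {T : ℝ → ℝ → (E ≃L[ℝ] E)} (hT : IsCocycle T) (τ : ℝ) :
    IsCocycle (shift T τ) where
  refl s hs x := by
    rw [shift_apply T τ hs hs, hT.refl s hs, div_self (by positivity), Real.one_rpow, one_smul]
  comp t r s hs hr ht x := by
    rw [shift_apply T τ ht hr, shift_apply T τ hr hs, shift_apply T τ ht hs, map_smul,
      hT.comp t r s hs hr ht, smul_smul, ← Real.mul_rpow (by positivity) (by positivity)]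
    congr 2
    field_simp

theorem norm_shift_apply {T : ℝ → ℝ → (E ≃L[ℝ] E)} {N : ℝ → E → ℝ}
    (hN : ∀ t : ℝ, 1 ≤ t → IsNormOn (N t)) (τ : ℝ) {t s : ℝ} (ht : 1 ≤ t) (hs : 1 ≤ s) (x : E) :
    N t (shift T τ t s x) = (t / s) ^ (-τ) * N t (T t s x) := by
  rw [shift_apply T τ ht hs, (hN t ht).2.2.1, abs_of_nonneg (by positivity)]

theorem norm_shift_apply_inv {T : ℝ → ℝ → (E ≃L[ℝ] E)} {N : ℝ → E → ℝ}
    (hN : ∀ t : ℝ, 1 ≤ t → IsNormOn (N t)) (τ : ℝ) {t s : ℝ} (ht : 1 ≤ t) (hs : 1 ≤ s) (x : E) :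
    N s (shift T τ s t x) = (t / s) ^ (-(-τ)) * N s (T s t x) := by
  rw [norm_shift_apply hN τ hs ht, ← inv_div, Real.inv_rpow (by positivity),
    Real.rpow_neg (by positivity) (-τ)]

theorem rpow_neg_mul_le_iff {u : ℝ} (hu : 0 < u) (τ p K A B : ℝ) :
    u ^ (-τ) * A ≤ K * u ^ p * B ↔ A ≤ K * u ^ (τ + p) * B := by
  have h := Real.rpow_pos_of_pos hu τ
  rw [Real.rpow_neg hu.le, Real.rpow_add hu, inv_mul_le_iff₀ h,
    show u ^ τ * (K * u ^ p * B) = K * (u ^ τ * u ^ p) * B by ring]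

theorem HasPolyGrowth.shift {T : ℝ → ℝ → (E ≃L[ℝ] E)} {N : ℝ → E → ℝ}
    (hN : ∀ t : ℝ, 1 ≤ t → IsNormOn (N t)) {K a : ℝ} (hK : 0 < K) (h : HasPolyGrowth T N K a)
    (τ : ℝ) : HasPolyGrowth (shift T τ) N K (a + |τ|) := by
  intro t s hs hst x
  have ht : 1 ≤ t := hs.trans hst
  have hu : 1 ≤ t / s := (one_le_div (by linarith)).2 hst
  rw [norm_shift_apply hN τ ht hs, norm_shift_apply_inv hN τ ht hs,
    rpow_neg_mul_le_iff (by linarith), rpow_neg_mul_le_iff (by linarith)]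
  have key : ∀ p : ℝ, a ≤ p → ∀ y z : ℝ, 0 ≤ z → y ≤ K * (t / s) ^ a * z →
      y ≤ K * (t / s) ^ p * z := fun p hp y z hz hy => hy.trans <| by gcongr
  exact ⟨key _ (by linarith [neg_abs_le τ]) _ _ ((hN s hs).1 x) (h t s hs hst x).1,
    key _ (by linarith [le_abs_self τ]) _ _ ((hN t ht).1 x) (h t s hs hst x).2⟩

theorem cStrongPolyDichotomyWRT_shift_iff {T : ℝ → ℝ → (E ≃L[ℝ] E)} {N : ℝ → E → ℝ}
    (hN : ∀ t : ℝ, 1 ≤ t → IsNormOn (N t)) {K a : ℝ} (hK : 0 < K)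
    (h : HasPolyGrowth T N K a) (τ : ℝ) :
    CStrongPolyDichotomyWRT (shift T τ) N ↔
      ∃ K' lam P, 0 < K' ∧ 0 < lam ∧ HasPolyDichotomyAt T N τ K' lam P := by
  constructor
  · rintro ⟨K', lam, _, hK', hlam, -, P, hP, hinv, hb⟩
    refine ⟨K', lam, P, hK', hlam, hP, ?_, ?_⟩
    · intro t s hs hst x
      have ht : 1 ≤ t := hs.trans hst
      have := DFunLike.congr_fun (hinv t s hs hst) x
      simp only [ContinuousLinearMap.comp_apply, ContinuousLinearEquiv.coe_coe,
        shift_apply T τ ht hs, map_smul] at this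
      exact smul_right_injective E (by positivity : (t / s) ^ (-τ) ≠ 0) this
    · intro t s hs hst x
      have ht : 1 ≤ t := hs.trans hst
      obtain ⟨h1, h2, -⟩ := hb t s hs hst x
      rw [norm_shift_apply hN τ ht hs, rpow_neg_mul_le_iff (by positivity)] at h1
      rw [norm_shift_apply_inv hN τ ht hs, rpow_neg_mul_le_iff (by positivity)] at h2
      exact ⟨h1, h2⟩
  · rintro ⟨K', lam, P, hK', hlam, hP, hinv, hb⟩
    have hg := h.shift hN hK τ
    refine ⟨max K' K, lam, max lam (a + |τ|), lt_max_of_lt_left hK', hlam, le_max_left _ _,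
      P, hP, ?_, ?_⟩
    · intro t s hs hst
      have ht : 1 ≤ t := hs.trans hst
      ext1 x
      simp only [ContinuousLinearMap.comp_apply, ContinuousLinearEquiv.coe_coe,
        shift_apply T τ ht hs, map_smul, hinv t s hs hst]
    · intro t s hs hst x
      have ht : 1 ≤ t := hs.trans hst
      have hu : 1 ≤ t / s := (one_le_div (by linarith)).2 hst
      have hNs := (hN s hs).1 x
      have hNt := (hN t ht).1 x
      obtain ⟨h1, h2⟩ := hb t s hs hst x
      rw [← rpow_neg_mul_le_iff (by positivity), ← norm_shift_apply hN τ ht hs] at h1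
      rw [← rpow_neg_mul_le_iff (by positivity), ← norm_shift_apply_inv hN τ ht hs] at h2
      obtain ⟨h3, h4⟩ := hg t s hs hst x
      refine ⟨h1.trans ?_, h2.trans ?_, h3.trans ?_, h4.trans ?_⟩
      · gcongr; exact le_max_left _ _
      · gcongr; exact le_max_left _ _
      · gcongr
        · exact le_max_right _ _
        · exact le_max_right _ _
      · gcongr
        · exact le_max_right _ _
        · exact le_max_right _ _

theorem IsCocycle.fwd_apply {T : ℝ → ℝ → (E ≃L[ℝ] E)} (hT : IsCocycle T) {n : ℕ} (hn : 1 ≤ n)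
    (k : ℕ) (x : E) :
    fwd (fun n : ℕ => T ((n : ℝ) + 1) (n : ℝ)) n k x = T ((n + k : ℕ) : ℝ) (n : ℝ) x := by
  have hn' : (1 : ℝ) ≤ n := by exact_mod_cast hn
  induction k with
  | zero => simp only [fwd, Nat.add_zero, ContinuousLinearEquiv.refl_apply, hT.refl _ hn']
  | succ k ih =>
    have h1 : (1 : ℝ) ≤ ((n + k : ℕ) : ℝ) := by exact_mod_cast hn.trans (Nat.le_add_right n k)
    simp only [fwd, ContinuousLinearEquiv.trans_apply, ih]
    rw [hT.comp _ _ _ hn' h1 (by linarith)]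
    congr 2
    push_cast
    ring

theorem IsCocycle.coc_apply {T : ℝ → ℝ → (E ≃L[ℝ] E)} (hT : IsCocycle T) {m n : ℕ} (hm : 1 ≤ m)
    (hn : 1 ≤ n) (x : E) :
    coc (fun n : ℕ => T ((n : ℝ) + 1) (n : ℝ)) m n x = T (m : ℝ) (n : ℝ) x := by
  have hm' : (1 : ℝ) ≤ m := by exact_mod_cast hm
  have hn' : (1 : ℝ) ≤ n := by exact_mod_cast hn
  unfold coc
  split_ifs with h
  · rw [hT.fwd_apply hn, Nat.add_sub_cancel' h]
  · rw [ContinuousLinearEquiv.symm_apply_eq, hT.fwd_apply hm, Nat.add_sub_cancel' (by omega),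
      hT.comp _ _ _ hn' hm' hn', hT.refl _ hn']

theorem IsCocycle.strong_of_cStrong {T : ℝ → ℝ → (E ≃L[ℝ] E)} (hT : IsCocycle T)
    {N : ℝ → E → ℝ} (h : CStrongPolyDichotomyWRT T N) :
    StrongPolyDichotomyWRT (fun n : ℕ => T ((n : ℝ) + 1) (n : ℝ)) (fun n : ℕ => N (n : ℝ)) := by
  obtain ⟨K, lam, a, hK, hlam, hla, P, hP, hinv, hb⟩ := h
  refine ⟨K, lam, a, hK, hlam, hla, fun n => P n, fun n hn => hP n (by exact_mod_cast hn),
    fun n hn => ?_, fun m n hn hnm x => ?_⟩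
  · have := hinv ((n : ℝ) + 1) n (by exact_mod_cast hn) (by linarith)
    push_cast
    exact this.symm
  · simp only [hT.coc_apply hn (hn.trans hnm), hT.coc_apply (hn.trans hnm) hn]
    exact hb m n (by exact_mod_cast hn) (by exact_mod_cast hnm) x

theorem IsCocycle.cStrong_of_strong {T : ℝ → ℝ → (E ≃L[ℝ] E)} (hT : IsCocycle T)
    {N : ℝ → E → ℝ} (hN : ∀ t : ℝ, 1 ≤ t → IsNormOn (N t)) {K a : ℝ} (hK : 0 < K) (ha : 0 ≤ a)
    (hg : HasPolyGrowth T N K a)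
    (h : StrongPolyDichotomyWRT (fun n : ℕ => T ((n : ℝ) + 1) (n : ℝ))
      (fun n : ℕ => N (n : ℝ))) : CStrongPolyDichotomyWRT T N := by
  obtain ⟨K₁, lam, _, hK₁, hlam, -, P, hP, hinv, hb⟩ := h
  have hinv1 : ∀ n : ℕ, 1 ≤ n → ∀ x, P n (T n 1 x) = T n 1 (P 1 x) := by
    intro n hn
    induction n, hn using Nat.le_induction with
    | base => intro x; rw [Nat.cast_one, hT.refl 1 le_rfl, hT.refl 1 le_rfl]
    | succ n hn ih =>
      intro x
      have hn' : (1 : ℝ) ≤ n := by exact_mod_cast hn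
      have := DFunLike.congr_fun (hinv n hn) (T n 1 x)
      simp only [ContinuousLinearMap.comp_apply, ContinuousLinearEquiv.coe_coe, ih] at this
      rw [hT.comp _ _ _ le_rfl hn' (by linarith), hT.comp _ _ _ le_rfl hn' (by linarith)] at this
      push_cast
      exact this.symm
  set Q : ℝ → (E →L[ℝ] E) := fun t =>
    ((T t 1 : E →L[ℝ] E).comp (P 1)).comp (T 1 t : E →L[ℝ] E) with hQ
  have hQa : ∀ t x, Q t x = T t 1 (P 1 (T 1 t x)) := fun t x => rfl
  have hQn : ∀ n : ℕ, 1 ≤ n → ∀ x, Q n x = P n x := by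
    intro n hn x
    have hn' : (1 : ℝ) ≤ n := by exact_mod_cast hn
    rw [hQa, ← hinv1 n hn, hT.comp _ _ _ hn' le_rfl hn', hT.refl _ hn']
  have hQinv : ∀ t s : ℝ, 1 ≤ s → 1 ≤ t → ∀ x, Q t (T t s x) = T t s (Q s x) := by
    intro t s hs ht x
    rw [hQa, hQa, hT.comp _ _ _ hs ht le_rfl, hT.comp _ _ _ le_rfl hs ht]
  have hKa : 0 < K * 2 ^ a := by positivity
  refine ⟨max ((K * 2 ^ a) * (K₁ * 2 ^ lam) * (K * 2 ^ a)) K, lam, max lam a,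
    lt_max_of_lt_right hK, hlam, le_max_left _ _, Q, ?_, ?_, ?_⟩
  · intro t ht
    ext1 x
    rw [ContinuousLinearMap.comp_apply, hQa t (Q t x), hQa t x, hT.comp _ _ _ le_rfl ht le_rfl,
      hT.refl _ le_rfl]
    exact congrArg _ (DFunLike.congr_fun (hP 1 le_rfl) _)
  · intro t s hs hst
    ext1 x
    exact hQinv t s hs (hs.trans hst) x
  intro t s hs hst x
  have ht : 1 ≤ t := hs.trans hst
  have hu : 1 ≤ t / s := (one_le_div (by linarith)).2 hst
  have hNs := (hN s hs).1 x
  have hNt := (hN t ht).1 x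
  obtain ⟨h3, h4⟩ := hg t s hs hst x
  -- comparison with the integer parts
  have floor_bounds : ∀ q : ℝ, 1 ≤ q → 1 ≤ ⌊q⌋₊ ∧ (⌊q⌋₊ : ℝ) ≤ q ∧ q ≤ 2 * ⌊q⌋₊ := by
    intro q hq
    have h1 : 1 ≤ ⌊q⌋₊ := Nat.le_floor (by exact_mod_cast hq)
    have h2 : (1 : ℝ) ≤ ⌊q⌋₊ := by exact_mod_cast h1
    have := Nat.lt_floor_add_one q
    exact ⟨h1, Nat.floor_le (by linarith), by linarith⟩
  have growth_floor : ∀ q : ℝ, 1 ≤ q → ∀ y, N q (T q ⌊q⌋₊ y) ≤ K * 2 ^ a * N ⌊q⌋₊ y ∧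
      N ⌊q⌋₊ (T ⌊q⌋₊ q y) ≤ K * 2 ^ a * N q y := by
    intro q hq y
    obtain ⟨h1, h2, h3⟩ := floor_bounds q hq
    have h1' : (1 : ℝ) ≤ ⌊q⌋₊ := by exact_mod_cast h1
    have h5 : q / ⌊q⌋₊ ≤ 2 := by rw [div_le_iff₀ (by linarith)]; exact h3
    have h6 : (q / ⌊q⌋₊) ^ a ≤ 2 ^ a := Real.rpow_le_rpow (by positivity) h5 ha
    have h7 := (hN q hq).1 y
    have h8 := (hN _ h1').1 y
    obtain ⟨g1, g2⟩ := hg q ⌊q⌋₊ h1' h2 y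
    exact ⟨g1.trans (by gcongr), g2.trans (by gcongr)⟩
  obtain ⟨m, n, hnm, hn, ⟨-, htm⟩, ⟨hns, -⟩, gt, gs⟩ : ∃ m n : ℕ, n ≤ m ∧ 1 ≤ n ∧
      ((m : ℝ) ≤ t ∧ t ≤ 2 * m) ∧ ((n : ℝ) ≤ s ∧ s ≤ 2 * n) ∧
      (∀ y, N t (T t m y) ≤ K * 2 ^ a * N m y ∧ N m (T m t y) ≤ K * 2 ^ a * N t y) ∧
      (∀ y, N s (T s n y) ≤ K * 2 ^ a * N n y ∧ N n (T n s y) ≤ K * 2 ^ a * N s y) :=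
    ⟨⌊t⌋₊, ⌊s⌋₊, Nat.floor_mono hst, (floor_bounds s hs).1, (floor_bounds t ht).2,
      (floor_bounds s hs).2, growth_floor t ht, growth_floor s hs⟩
  have hm : 1 ≤ m := hn.trans hnm
  have hm' : (1 : ℝ) ≤ m := by exact_mod_cast hm
  have hn' : (1 : ℝ) ≤ n := by exact_mod_cast hn
  have hrate : ((m : ℝ) / n) ^ (-lam) ≤ 2 ^ lam * (t / s) ^ (-lam) := by
    have h1 : t / s / 2 ≤ (m : ℝ) / n := by
      rw [div_div, div_le_div_iff₀ (by positivity) (by positivity)]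
      nlinarith
    calc ((m : ℝ) / n) ^ (-lam) ≤ (t / s / 2) ^ (-lam) :=
          Real.rpow_le_rpow_of_nonpos (by positivity) h1 (by linarith)
      _ = 2 ^ lam * (t / s) ^ (-lam) := by
          rw [Real.div_rpow (by positivity) (by positivity), Real.rpow_neg (by norm_num : (0:ℝ) ≤ 2),
            div_inv_eq_mul, mul_comm]
  refine ⟨?_, ?_, h3.trans ?_, h4.trans ?_⟩
  · have e : T t s (Q s x) = T t m (coc (fun n : ℕ => T ((n : ℝ) + 1) (n : ℝ)) m n
        (P n (T n s x))) := by
      rw [hT.coc_apply hm hn, ← hQn n hn, hQinv n s hs hn', hT.comp _ _ _ hs hn' hm',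
        hT.comp _ _ _ hs hm' ht]
    rw [e]
    calc _ ≤ K * 2 ^ a * _ := (gt _).1
      _ ≤ K * 2 ^ a * (K₁ * ((m : ℝ) / n) ^ (-lam) * N n (T n s x)) := by
          gcongr; exact (hb m n hn hnm _).1
      _ ≤ K * 2 ^ a * (K₁ * (2 ^ lam * (t / s) ^ (-lam)) * (K * 2 ^ a * N s x)) := by
          gcongr
          · exact (hN _ hn').1 _
          · exact (gs x).2
      _ = ((K * 2 ^ a) * (K₁ * 2 ^ lam) * (K * 2 ^ a)) * (t / s) ^ (-lam) * N s x := by ring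
      _ ≤ _ := by gcongr; exact le_max_left _ _
  · have e : T s t (x - Q t x) = T s n (coc (fun n : ℕ => T ((n : ℝ) + 1) (n : ℝ)) n m
        (T m t x - P m (T m t x))) := by
      rw [hT.coc_apply hn hm, ← hQn m hm, hQinv m t ht hm', ← map_sub,
        hT.comp _ _ _ ht hm' hn', hT.comp _ _ _ ht hn' hs]
    rw [e]
    calc _ ≤ K * 2 ^ a * _ := (gs _).1
      _ ≤ K * 2 ^ a * (K₁ * ((m : ℝ) / n) ^ (-lam) * N m (T m t x)) := by
          gcongr; exact (hb m n hn hnm _).2.1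
      _ ≤ K * 2 ^ a * (K₁ * (2 ^ lam * (t / s) ^ (-lam)) * (K * 2 ^ a * N t x)) := by
          gcongr
          · exact (hN _ hm').1 _
          · exact (gt x).2
      _ = ((K * 2 ^ a) * (K₁ * 2 ^ lam) * (K * 2 ^ a)) * (t / s) ^ (-lam) * N t x := by ring
      _ ≤ _ := by gcongr; exact le_max_left _ _
  · gcongr
    · exact le_max_right _ _
    · exact le_max_right _ _
  · gcongr
    · exact le_max_right _ _
    · exact le_max_right _ _

/-- The initial conditions at time `1` whose trajectories are `O(t ^ τ)`. -/
def stableSubspace (T : ℝ → ℝ → (E ≃L[ℝ] E)) {N : ℝ → E → ℝ}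
    (hN : ∀ t : ℝ, 1 ≤ t → IsNormOn (N t)) (τ : ℝ) : Submodule ℝ E where
  carrier := {x | ∃ C, ∀ t : ℝ, 1 ≤ t → N t (T t 1 x) ≤ C * t ^ τ}
  zero_mem' := ⟨0, fun t ht => by rw [map_zero, ((hN t ht).2.1 0).2 rfl, zero_mul]⟩
  add_mem' := by
    rintro x y ⟨C, hC⟩ ⟨D, hD⟩
    refine ⟨C + D, fun t ht => ?_⟩
    rw [map_add, add_mul]
    exact ((hN t ht).2.2.2 _ _).trans (add_le_add (hC t ht) (hD t ht))
  smul_mem' := by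
    rintro c x ⟨C, hC⟩
    refine ⟨|c| * C, fun t ht => ?_⟩
    rw [map_smul, (hN t ht).2.2.1, mul_assoc]
    exact mul_le_mul_of_nonneg_left (hC t ht) (abs_nonneg c)

theorem stableSubspace_mono (T : ℝ → ℝ → (E ≃L[ℝ] E)) {N : ℝ → E → ℝ}
    (hN : ∀ t : ℝ, 1 ≤ t → IsNormOn (N t)) : Monotone (stableSubspace T hN) := by
  rintro τ τ' h x ⟨C, hC⟩
  have hC0 : 0 ≤ C := by
    have := ((hN 1 le_rfl).1 _).trans (hC 1 le_rfl)
    rwa [Real.one_rpow, mul_one] at this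
  exact ⟨C, fun t ht => (hC t ht).trans
    (mul_le_mul_of_nonneg_left (Real.rpow_le_rpow_of_exponent_le ht h) hC0)⟩

theorem HasPolyDichotomyAt.mem_stableSubspace_iff {T : ℝ → ℝ → (E ≃L[ℝ] E)} (hT : IsCocycle T)
    {N : ℝ → E → ℝ} (hN : ∀ t : ℝ, 1 ≤ t → IsNormOn (N t)) {τ K lam : ℝ} {P : ℝ → (E →L[ℝ] E)}
    (hK : 0 < K) (hlam : 0 < lam) (h : HasPolyDichotomyAt T N τ K lam P) (x : E) :
    x ∈ stableSubspace T hN τ ↔ P 1 x = x := by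
  obtain ⟨hP, hinv, hb⟩ := h
  constructor
  · rintro ⟨C, hC⟩
    have hle : ∀ t : ℝ, 1 ≤ t → N 1 (x - P 1 x) ≤ K * C * t ^ (-lam) := by
      intro t ht
      have h1 := (hb t 1 le_rfl ht (T t 1 x)).2
      rw [hinv t 1 le_rfl ht, ← map_sub, hT.comp _ _ _ le_rfl ht le_rfl, hT.refl _ le_rfl,
        div_one, Real.rpow_add (by linarith)] at h1
      have h2 := hC t ht
      calc _ ≤ _ := h1
        _ ≤ K * (t ^ (-τ) * t ^ (-lam)) * (C * t ^ τ) := by gcongr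
        _ = K * C * t ^ (-lam) * (t ^ (-τ) * t ^ τ) := by ring
        _ = _ := by
          rw [← Real.rpow_add (by linarith), neg_add_cancel, Real.rpow_zero, mul_one]
    have hlim : Filter.Tendsto (fun t : ℝ => K * C * t ^ (-lam)) Filter.atTop (nhds 0) := by
      simpa using (tendsto_rpow_neg_atTop hlam).const_mul (K * C)
    have h0 : N 1 (x - P 1 x) ≤ 0 := ge_of_tendsto hlim
      (Filter.eventually_atTop.2 ⟨1, hle⟩)
    have := ((hN 1 le_rfl).2.1 _).1 (le_antisymm h0 ((hN 1 le_rfl).1 _))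
    exact (sub_eq_zero.1 this).symm
  · intro hx
    refine ⟨K * N 1 x, fun t ht => ?_⟩
    have h1 := (hb t 1 le_rfl ht x).1
    rw [hx, div_one] at h1
    have hN1 := (hN 1 le_rfl).1 x
    have h2 : t ^ (τ + -lam) ≤ t ^ τ := Real.rpow_le_rpow_of_exponent_le ht (by linarith)
    calc _ ≤ _ := h1
      _ ≤ K * t ^ τ * N 1 x := by gcongr
      _ = _ := by ring

theorem HasPolyDichotomyAt.change_exponent {T : ℝ → ℝ → (E ≃L[ℝ] E)}
    {N : ℝ → E → ℝ} (hN : ∀ t : ℝ, 1 ≤ t → IsNormOn (N t)) {τ τ' K lam : ℝ}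
    {P : ℝ → (E →L[ℝ] E)} (hK : 0 < K) (h : HasPolyDichotomyAt T N τ K lam P) :
    HasPolyDichotomyAt T N τ' K (lam - |τ' - τ|) P := by
  obtain ⟨hP, hinv, hb⟩ := h
  refine ⟨hP, hinv, fun t s hs hst x => ?_⟩
  have hu : 1 ≤ t / s := (one_le_div (by linarith)).2 hst
  have hNs := (hN s hs).1 x
  have hNt := (hN t (hs.trans hst)).1 x
  obtain ⟨h1, h2⟩ := hb t s hs hst x
  refine ⟨h1.trans ?_, h2.trans ?_⟩
  · refine mul_le_mul_of_nonneg_right (mul_le_mul_of_nonneg_left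
      (Real.rpow_le_rpow_of_exponent_le hu ?_) hK.le) hNs
    linarith [neg_abs_le (τ' - τ)]
  · refine mul_le_mul_of_nonneg_right (mul_le_mul_of_nonneg_left
      (Real.rpow_le_rpow_of_exponent_le hu ?_) hK.le) hNt
    linarith [le_abs_self (τ' - τ)]

theorem HasPolyDichotomyAt.of_mem_Icc {T : ℝ → ℝ → (E ≃L[ℝ] E)} (hT : IsCocycle T)
    {N : ℝ → E → ℝ} (hN : ∀ t : ℝ, 1 ≤ t → IsNormOn (N t)) {τ τ₁ τ₂ K₁ K₂ lam₁ lam₂ : ℝ}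
    {P₁ P₂ : ℝ → (E →L[ℝ] E)} (hK₁ : 0 < K₁) (hK₂ : 0 < K₂) (hlam₁ : 0 < lam₁) (hlam₂ : 0 < lam₂)
    (h₁ : HasPolyDichotomyAt T N τ₁ K₁ lam₁ P₁) (h₂ : HasPolyDichotomyAt T N τ₂ K₂ lam₂ P₂)
    (heq : stableSubspace T hN τ₁ = stableSubspace T hN τ₂) (hτ₁ : τ₁ ≤ τ) (hτ₂ : τ ≤ τ₂) :
    HasPolyDichotomyAt T N τ (max (K₁ * K₂) K₂) (min lam₁ lam₂) P₂ := by
  have hfix : ∀ x, P₁ 1 (P₂ 1 x) = P₂ 1 x := by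
    intro x
    rw [← h₁.mem_stableSubspace_iff hT hN hK₁ hlam₁, heq,
      h₂.mem_stableSubspace_iff hT hN hK₂ hlam₂]
    exact DFunLike.congr_fun (h₂.1 1 le_rfl) x
  have hfix' : ∀ s : ℝ, 1 ≤ s → ∀ x, P₁ s (P₂ s x) = P₂ s x := by
    intro s hs x
    obtain ⟨y, rfl⟩ : ∃ y, x = T s 1 y :=
      ⟨T 1 s x, by rw [hT.comp _ _ _ hs le_rfl hs, hT.refl _ hs]⟩
    rw [h₂.2.1 s 1 le_rfl hs, h₁.2.1 s 1 le_rfl hs, hfix]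
  refine ⟨h₂.1, h₂.2.1, fun t s hs hst x => ?_⟩
  have ht : 1 ≤ t := hs.trans hst
  have hu : 1 ≤ t / s := (one_le_div (by linarith)).2 hst
  have hNs := (hN s hs).1 x
  have hNt := (hN t ht).1 x
  constructor
  · have b1 := (h₁.2.2 t s hs hst (P₂ s x)).1
    have b2 := (h₂.2.2 s s hs le_rfl x).1
    rw [hfix' s hs] at b1
    rw [hT.refl s hs, div_self (by positivity), Real.one_rpow, mul_one] at b2
    calc _ ≤ _ := b1
      _ ≤ K₁ * (t / s) ^ (τ₁ + -lam₁) * (K₂ * N s x) := by gcongr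
      _ = K₁ * K₂ * (t / s) ^ (τ₁ + -lam₁) * N s x := by ring
      _ ≤ _ := by
        gcongr
        · exact le_max_left _ _
        · exact min_le_left _ _
  · refine (h₂.2.2 t s hs hst x).2.trans ?_
    gcongr
    · exact le_max_right _ _
    · exact min_le_right _ _

theorem hasPolyDichotomyAt_zero {T : ℝ → ℝ → (E ≃L[ℝ] E)}
    {N : ℝ → E → ℝ} (hN : ∀ t : ℝ, 1 ≤ t → IsNormOn (N t)) {K a τ : ℝ} (hK : 0 < K)
    (hg : HasPolyGrowth T N K a) (hτ : τ ≤ -(a + 1)) :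
    HasPolyDichotomyAt T N τ K 1 (fun _ => 0) := by
  refine ⟨fun t _ => by simp, fun t s _ _ x => by simp, fun t s hs hst x => ?_⟩
  have ht : 1 ≤ t := hs.trans hst
  have hu : 1 ≤ t / s := (one_le_div (by linarith)).2 hst
  have hNs := (hN s hs).1 x
  have hNt := (hN t ht).1 x
  constructor
  · simp only [zero_apply, map_zero, ((hN t ht).2.1 0).2 rfl]
    positivity
  · simp only [zero_apply, sub_zero]
    refine (hg t s hs hst x).2.trans ?_
    gcongr
    linarith

theorem hasPolyDichotomyAt_id {T : ℝ → ℝ → (E ≃L[ℝ] E)}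
    {N : ℝ → E → ℝ} (hN : ∀ t : ℝ, 1 ≤ t → IsNormOn (N t)) {K a τ : ℝ} (hK : 0 < K)
    (hg : HasPolyGrowth T N K a) (hτ : a + 1 ≤ τ) :
    HasPolyDichotomyAt T N τ K 1 (fun _ => ContinuousLinearMap.id ℝ E) := by
  refine ⟨fun t _ => by simp, fun t s _ _ x => by simp, fun t s hs hst x => ?_⟩
  have ht : 1 ≤ t := hs.trans hst
  have hu : 1 ≤ t / s := (one_le_div (by linarith)).2 hst
  have hNs := (hN s hs).1 x
  have hNt := (hN t ht).1 x
  constructor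
  · simp only [ContinuousLinearMap.id_apply]
    refine (hg t s hs hst x).1.trans ?_
    gcongr
    linarith
  · simp only [ContinuousLinearMap.id_apply, sub_self, map_zero, ((hN s hs).2.1 0).2 rfl]
    positivity

theorem sigmaPDc_eq_sigmaPD {T : ℝ → ℝ → (E ≃L[ℝ] E)} (hT : IsCocycle T)
    {N : ℝ → E → ℝ} (hN : ∀ t : ℝ, 1 ≤ t → IsNormOn (N t)) {K a : ℝ} (hK : 0 < K) (ha : 0 ≤ a)
    (hg : HasPolyGrowth T N K a) :
    SigmaPDc T N =
      SigmaPD (fun n : ℕ => T ((n : ℝ) + 1) (n : ℝ)) (fun n : ℕ => N (n : ℝ)) := by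
  ext τ
  exact not_congr ⟨(hT.shift τ).strong_of_cStrong,
    (hT.shift τ).cStrong_of_strong hN hK (by positivity) (hg.shift hN hK τ)⟩

theorem exists_sigmaPDc_eq_iUnion_Icc [FiniteDimensional ℝ E] (hE : 1 ≤ Module.finrank ℝ E)
    {T : ℝ → ℝ → (E ≃L[ℝ] E)} (hT : IsCocycle T)
    {N : ℝ → E → ℝ} (hN : ∀ t : ℝ, 1 ≤ t → IsNormOn (N t)) {K a : ℝ} (hK : 0 < K)
    (hg : HasPolyGrowth T N K a) :
    ∃ r : ℕ, 1 ≤ r ∧ r ≤ Module.finrank ℝ E ∧ ∃ α β : ℕ → ℝ,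
      (∀ i, 1 ≤ i → i ≤ r → α i ≤ β i) ∧
      (∀ i, 1 ≤ i → i < r → β i < α (i + 1)) ∧
      SigmaPDc T N = ⋃ i ∈ Finset.Icc 1 r, Set.Icc (α i) (β i) := by
  have hmem : ∀ τ, τ ∉ SigmaPDc T N ↔
      ∃ K' lam P, 0 < K' ∧ 0 < lam ∧ HasPolyDichotomyAt T N τ K' lam P := fun τ =>
    not_not.trans (cStrongPolyDichotomyWRT_shift_iff hN hK hg τ)
  refine exists_Icc_decomposition (f := fun τ => Module.finrank ℝ (stableSubspace T hN τ)) hE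
    (fun τ => Submodule.finrank_le _)
    (fun τ τ' h => Submodule.finrank_mono (stableSubspace_mono T hN h)) ?_ ?_ ?_ ?_
  · intro τ hτ
    obtain ⟨K', lam, P, hK', hlam, h⟩ := (hmem τ).1 hτ
    refine ⟨lam, hlam, fun τ' hτ' => ?_⟩
    have h' := h.change_exponent (τ' := τ') hN hK'
    have hlam' : 0 < lam - |τ' - τ| := by linarith
    refine ⟨(hmem τ').2 ⟨_, _, _, hK', hlam', h'⟩, ?_⟩
    have : stableSubspace T hN τ' = stableSubspace T hN τ := by
      ext x
      rw [h.mem_stableSubspace_iff hT hN hK' hlam, h'.mem_stableSubspace_iff hT hN hK' hlam']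
    rw [this]
  · intro τ₁ τ τ₂ hτ₁ hτ₂ hf h1 h2
    obtain ⟨K₁, lam₁, P₁, hK₁, hlam₁, hd₁⟩ := (hmem τ₁).1 hτ₁
    obtain ⟨K₂, lam₂, P₂, hK₂, hlam₂, hd₂⟩ := (hmem τ₂).1 hτ₂
    have heq : stableSubspace T hN τ₁ = stableSubspace T hN τ₂ :=
      Submodule.eq_of_le_of_finrank_eq (stableSubspace_mono T hN (h1.trans h2)) hf
    exact (hmem τ).2 ⟨_, _, _, lt_max_of_lt_right hK₂, lt_min hlam₁ hlam₂,
      hd₁.of_mem_Icc hT hN hK₁ hK₂ hlam₁ hlam₂ hd₂ heq h1 h2⟩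
  · refine ⟨-(a + 1), fun τ hτ => ?_⟩
    have h := hasPolyDichotomyAt_zero hN hK hg hτ
    refine ⟨(hmem τ).2 ⟨_, _, _, hK, one_pos, h⟩, ?_⟩
    have : stableSubspace T hN τ = ⊥ := by
      ext x
      rw [h.mem_stableSubspace_iff hT hN hK one_pos, Submodule.mem_bot]
      exact eq_comm
    rw [this, finrank_bot]
  · refine ⟨a + 1, fun τ hτ => ?_⟩
    have h := hasPolyDichotomyAt_id hN hK hg hτ
    refine ⟨(hmem τ).2 ⟨_, _, _, hK, one_pos, h⟩, ?_⟩
    have : stableSubspace T hN τ = ⊤ := by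
      ext x
      rw [h.mem_stableSubspace_iff hT hN hK one_pos]
      simp
    rw [this, finrank_top]

/-- Corollary: the continuous-time polynomial dichotomy spectrum
coincides with the discrete one and has the band structure. -/
theorem sigmaPDc_eq_sigmaPD_and_structure {d : ℕ} (hd : 1 ≤ d)
    (A : ℝ → (EuclideanSpace ℝ (Fin d) →L[ℝ] EuclideanSpace ℝ (Fin d)))
    (hA : ContinuousOn A (Set.Ici 1))
    (T : ℝ → ℝ → (EuclideanSpace ℝ (Fin d) ≃L[ℝ] EuclideanSpace ℝ (Fin d)))
    (hT : IsEvolutionFamily A T)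
    (N : ℝ → EuclideanSpace ℝ (Fin d) → ℝ)
    (hN : ∀ t : ℝ, 1 ≤ t → IsNormOn (N t))
    (K a : ℝ) (hK : 0 < K) (ha : 0 < a)
    (hbg : ∀ t s : ℝ, 1 ≤ s → s ≤ t → ∀ x : EuclideanSpace ℝ (Fin d),
      N t (T t s x) ≤ K * (t / s) ^ a * N s x ∧
      N s (T s t x) ≤ K * (t / s) ^ a * N t x) :
    SigmaPDc T N =
      SigmaPD (fun n : ℕ => T ((n : ℝ) + 1) (n : ℝ)) (fun n : ℕ => N (n : ℝ)) ∧
    ∃ r : ℕ, 1 ≤ r ∧ r ≤ d ∧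
      ∃ aa bb : ℕ → ℝ,
        (∀ i : ℕ, 1 ≤ i → i ≤ r → 0 < aa i ∧ aa i ≤ bb i) ∧
        (∀ i : ℕ, 1 ≤ i → i < r → bb i < aa (i + 1)) ∧
        SigmaPDc T N =
          ⋃ i ∈ Finset.Icc 1 r,
            Set.Icc (Real.log (aa i) / Real.log 2) (Real.log (bb i) / Real.log 2) := by
  have hTc : IsCocycle T := ⟨fun s hs x => by rw [hT.1 s hs]; rfl, hT.2.1⟩
  refine ⟨sigmaPDc_eq_sigmaPD hTc hN hK ha.le hbg, ?_⟩
  have hdim : Module.finrank ℝ (EuclideanSpace ℝ (Fin d)) = d := finrank_euclideanSpace_fin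
  obtain ⟨r, hr1, hrd, α, β, h1, h2, h3⟩ :=
    exists_sigmaPDc_eq_iUnion_Icc (hdim.symm ▸ hd) hTc hN hK hbg
  refine ⟨r, hr1, hdim ▸ hrd, fun i => 2 ^ α i, fun i => 2 ^ β i, fun i hi hir => ?_,
    fun i hi hir => ?_, ?_⟩
  · exact ⟨by positivity, Real.rpow_le_rpow_of_exponent_le one_le_two (h1 i hi hir)⟩
  · exact Real.rpow_lt_rpow_of_exponent_lt one_lt_two (h2 i hi hir)
  · have hlog : ∀ q : ℝ, Real.log (2 ^ q) / Real.log 2 = q := fun q => by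
      rw [Real.log_rpow two_pos, mul_div_cancel_right₀ _ (Real.log_pos one_lt_two).ne']
    simp only [hlog]
    exact h3


end NonautLin
end
end
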